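/- Let μ = (m, n−m) ⊢ n and let A be a row-standard μ-tableau which is not semistandard, so there exists i ≤ n−m with A(1,i) ≥ A(2,i); set j = A(1,i) and define the multisets R = {k ∈ A^1 : k < j}, S = {k ∈ A^1 : k ≥ j} ⊔ {k ∈ A^2 : k ≤ j}, T = {k ∈ A^2 : k > j}. Then: (a) |R| + |S| + |T| = n, |R| ≤ m and |S| > m, so R, S, T satisfy the hypotheses of the two-row Garnir relation; (b) A = A[U₀, V₀] where U₀ = {k ∈ A^1 : k ≥ j} and V₀ = {k ∈ A^2 : k ≤ j}, U₀ consists of the |U₀| largest elements of S, and the coefficient of φ̂_A in the Garnir relation equals 1; (c) consequently φ̂_A = −∑_{(U,V)∈𝒮, (U,V)≠(U₀,V₀)} (∏_i [R_i+U_i choose R_i]_q [T_i+V_i choose T_i]_q)(∏_{i<j} q^{R_j U_i + T_i V_j}) φ̂_{A[U,V]}, and every tableau A[U,V] with (U,V) ≠ (U₀,V₀) satisfies ∑_{k ∈ A[U,V]^1} k < ∑_{k ∈ A^1} k. -/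

import Mathlib

open scoped Classical

noncomputable section

namespace FayersSemistd

/-- The value at `q` of the Gaussian (quantum) binomial coefficient polynomial
`[a choose b]`, defined via the `q`-Pascal recurrence. -/
def qBinom {F : Type*} [Field F] (q : F) : ℕ → ℕ → F
  | _, 0 => 1
  | 0, _+1 => 0
  | a+1, b+1 => qBinom q a b + q ^ (b+1) * qBinom q a (b+1)

/-- `∏_i [A_i + B_i choose A_i]_q`, where `A_i`, `B_i` are multiplicities in the
multisets `A` and `B`. -/
def qBinomProd {F : Type*} [Field F] (q : F) (A B : Multiset ℕ) : F :=
  ∏ i ∈ (A + B).toFinset, qBinom q ((A + B).count i) (A.count i)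

/-- `∑_{i<j} A_j * B_i` : the number of pairs `(x,y)` with `x ∈ A`, `y ∈ B`, `y < x`,
counted with multiplicity. -/
def invPairs (A B : Multiset ℕ) : ℕ :=
  ((A.product B).filter (fun p => p.2 < p.1)).card

/-- The Coxeter length of a permutation of `{0,…,n-1}`: its number of inversions. -/
def permLength {n : ℕ} (w : Equiv.Perm (Fin n)) : ℕ :=
  (Finset.univ.filter (fun p : Fin n × Fin n => p.1 < p.2 ∧ w p.2 < w p.1)).card

/-- `λ_0 + ⋯ + λ_{r-1}`. -/
def cumSum (lam : ℕ → ℕ) (r : ℕ) : ℕ := ∑ i ∈ Finset.range r, lam i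

/-- The (0-indexed) row of the diagram of `λ` containing the (0-indexed) position `p`,
when positions are listed row by row. -/
def rowOf (lam : ℕ → ℕ) (p : ℕ) : ℕ := sInf {r | p < cumSum lam (r+1)}

/-- `λ` is a composition of `n`: finitely many nonzero parts, summing to `n`. -/
def IsComposition (n : ℕ) (lam : ℕ → ℕ) : Prop :=
  ∃ N, (∀ r, N ≤ r → lam r = 0) ∧ cumSum lam N = n

/-- `μ` is a partition of `n`. -/
def IsPartition (n : ℕ) (mu : ℕ → ℕ) : Prop := IsComposition n mu ∧ Antitone mu

/-- The conjugate partition (0-indexed): `conjP μ i = #{r | μ r > i}`. -/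
def conjP (mu : ℕ → ℕ) (i : ℕ) : ℕ := sInf {r | mu r ≤ i}

/-- The standard Young subgroup `W_λ` of `S_n` (as a set): the permutations preserving
each consecutive block of sizes `λ_0, λ_1, …`. -/
def youngW {n : ℕ} (lam : ℕ → ℕ) : Set (Equiv.Perm (Fin n)) :=
  {w | ∀ p : Fin n, rowOf lam ((w p : Fin n) : ℕ) = rowOf lam (p : ℕ)}

/-- The adjacent transposition `(i, i+1)` (0-indexed) in `S_n`. -/
def adjT {n : ℕ} (i : ℕ) (h : i + 1 < n) : Equiv.Perm (Fin n) :=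
  Equiv.swap ⟨i, Nat.lt_of_succ_lt h⟩ ⟨i+1, h⟩

/-- `T : S_n → H` is the standard basis of an Iwahori–Hecke algebra of `S_n` over `F`
with parameter `q`.  Permutations act on the right, so the product `w·s` of the paper
is `s * w` in Mathlib's convention; the multiplication rule
`T_w T_s = T_{ws}` (length increasing) resp. `T_w T_s = q T_{ws} + (q-1) T_w`
(length decreasing) determines the algebra structure on the basis. -/
structure IsHeckeBasis {F : Type*} [Field F] {H : Type*} [Ring H] [Algebra F H] {n : ℕ}
    (q : F) (T : Equiv.Perm (Fin n) → H) : Prop where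
  li : LinearIndependent F T
  total : Submodule.span F (Set.range T) = ⊤
  one : T 1 = 1
  mul_adj_asc : ∀ (w : Equiv.Perm (Fin n)) (i : ℕ) (h : i + 1 < n),
    permLength w < permLength (adjT i h * w) →
    T w * T (adjT i h) = T (adjT i h * w)
  mul_adj_desc : ∀ (w : Equiv.Perm (Fin n)) (i : ℕ) (h : i + 1 < n),
    permLength (adjT i h * w) < permLength w →
    T w * T (adjT i h) = q • T (adjT i h * w) + (q - 1) • T w

variable {F : Type*} [Field F] {H : Type*} [Ring H] [Algebra F H] {n : ℕ}

/-- `x_λ = ∑_{w ∈ W_λ} T_w`. -/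
def xElt (T : Equiv.Perm (Fin n) → H) (lam : ℕ → ℕ) : H :=
  ∑ w ∈ Finset.univ.filter (· ∈ youngW lam), T w

/-- `y_λ = ∑_{w ∈ W_λ} (-q)^{-l(w)} T_w`. -/
def yElt (q : F) (T : Equiv.Perm (Fin n) → H) (lam : ℕ → ℕ) : H :=
  ∑ w ∈ Finset.univ.filter (· ∈ youngW lam), ((-q)⁻¹) ^ permLength w • T w

/-- The double coset `W_λ d W_μ` (paper convention: maps act on the right, so the
paper product `u·d·v` is `v * d * u` in Mathlib's convention). -/
def doubleCoset {n : ℕ} (lam mu : ℕ → ℕ) (d : Equiv.Perm (Fin n)) :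
    Set (Equiv.Perm (Fin n)) :=
  {w | ∃ u ∈ youngW (n := n) lam, ∃ v ∈ youngW (n := n) mu, w = v * d * u}

/-- `∑_{w ∈ W_λ 1_A W_μ} T_w`, the image `x_μ φ_A` of `x_μ` under the tableau
homomorphism `φ_A : M^μ → M^λ`, where `d = 1_A`. -/
def XPhi (T : Equiv.Perm (Fin n) → H) (lam mu : ℕ → ℕ) (d : Equiv.Perm (Fin n)) : H :=
  ∑ w ∈ Finset.univ.filter (· ∈ doubleCoset lam mu d), T w

/-- A row-standard tableau is recorded by the multisets of entries of its rows; it has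
shape `μ` when row `r` has `μ_r` entries. -/
def RowsOfShape (mu : ℕ → ℕ) (A : ℕ → Multiset ℕ) : Prop := ∀ r, (A r).card = mu r

/-- The tableau with rows `A 0, A 1, …` has type `λ` when the entry `v` occurs `λ_v`
times in total (entries and types are 0-indexed). -/
def HasType (A : ℕ → Multiset ℕ) (lam : ℕ → ℕ) : Prop :=
  ∀ v, (∑ᶠ r, (A r).count v) = lam v

/-- The entry in row `r`, column `c` (0-indexed) of the row-standard tableau with row
multisets `A`. -/
def entryAt (A : ℕ → Multiset ℕ) (r c : ℕ) : ℕ := ((A r).sort (· ≤ ·)).getD c 0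

/-- `d = 1_A` for the row-standard `μ`-tableau `A` of type `λ`: the tableau `t^λ d`
(whose entry at position `p` is `d p`) is row-standard (first clause), and the entry
`d p` lies in row `r` of `t^λ d` exactly when the position occupied by `d p` in `t^μ`
is occupied by `r` in `A` (second clause). -/
def Is1A {n : ℕ} (mu lam : ℕ → ℕ) (A : ℕ → Multiset ℕ) (d : Equiv.Perm (Fin n)) : Prop :=
  (∀ p p' : Fin n, rowOf lam (p : ℕ) = rowOf lam (p' : ℕ) → p < p' → d p < d p') ∧
  (∀ p : Fin n,
    entryAt A (rowOf mu ((d p : Fin n) : ℕ))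
      (((d p : Fin n) : ℕ) - cumSum mu (rowOf mu ((d p : Fin n) : ℕ)))
      = rowOf lam (p : ℕ))

/-- A row-standard tableau is semistandard if its columns are strictly increasing. -/
def Semistandard (mu : ℕ → ℕ) (A : ℕ → Multiset ℕ) : Prop :=
  ∀ r c, c < mu (r+1) → entryAt A r c < entryAt A (r+1) c

/-- The (0-indexed) column of the position `p` in the diagram of `μ`. -/
def colIdx (mu : ℕ → ℕ) (p : ℕ) : ℕ := p - cumSum mu (rowOf mu p)

/-- `w = w_μ`, i.e. `t^μ w = t_μ`: the image of position `p` is the number of positions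
coming strictly before `p` in the column-reading order of the diagram of `μ`. -/
def IsWmu {n : ℕ} (mu : ℕ → ℕ) (w : Equiv.Perm (Fin n)) : Prop :=
  ∀ p : Fin n, ((w p : Fin n) : ℕ) = (Finset.univ.filter (fun p' : Fin n =>
    colIdx mu (p' : ℕ) < colIdx mu (p : ℕ) ∨
      (colIdx mu (p' : ℕ) = colIdx mu (p : ℕ) ∧ rowOf mu (p' : ℕ) < rowOf mu (p : ℕ)))).card

def comp1 (a : ℕ) : ℕ → ℕ := fun r => if r = 0 then a else 0
def comp2 (a b : ℕ) : ℕ → ℕ := fun r => if r = 0 then a else if r = 1 then b else 0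
def comp3 (a b c : ℕ) : ℕ → ℕ :=
  fun r => if r = 0 then a else if r = 1 then b else if r = 2 then c else 0
def comp4 (a b c d : ℕ) : ℕ → ℕ :=
  fun r => if r = 0 then a else if r = 1 then b else if r = 2 then c else if r = 3 then d else 0
def rows1 (a : Multiset ℕ) : ℕ → Multiset ℕ := fun r => if r = 0 then a else 0
def rows2 (a b : Multiset ℕ) : ℕ → Multiset ℕ :=
  fun r => if r = 0 then a else if r = 1 then b else 0
def rows3 (a b c : Multiset ℕ) : ℕ → Multiset ℕ :=
  fun r => if r = 0 then a else if r = 1 then b else if r = 2 then c else 0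
def rows4 (a b c d : Multiset ℕ) : ℕ → Multiset ℕ :=
  fun r => if r = 0 then a else if r = 1 then b else if r = 2 then c else if r = 3 then d else 0

end FayersSemistd
namespace FayersSemistd

section Length

variable {n : ℕ}

theorem perm_inv_apply (w : Equiv.Perm (Fin n)) (a : Fin n) : w⁻¹ (w a) = a :=
  w.symm_apply_apply a

theorem perm_apply_inv (w : Equiv.Perm (Fin n)) (a : Fin n) : w (w⁻¹ a) = a :=
  w.apply_symm_apply a

theorem adjT_left (i : ℕ) (h : i + 1 < n) :
    adjT i h ⟨i, Nat.lt_of_succ_lt h⟩ = ⟨i + 1, h⟩ := Equiv.swap_apply_left _ _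

theorem adjT_right (i : ℕ) (h : i + 1 < n) :
    adjT i h ⟨i + 1, h⟩ = ⟨i, Nat.lt_of_succ_lt h⟩ := Equiv.swap_apply_right _ _

theorem adjT_val (i : ℕ) (h : i + 1 < n) (a : Fin n) :
    ((adjT i h a : Fin n) : ℕ) =
      if (a : ℕ) = i then i + 1 else if (a : ℕ) = i + 1 then i else a := by
  unfold adjT
  rw [Equiv.swap_apply_def]
  simp only [Fin.ext_iff]
  split_ifs <;> rfl

theorem adjT_adjT (i : ℕ) (h : i + 1 < n) (a : Fin n) : adjT i h (adjT i h a) = a :=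
  Equiv.swap_apply_self _ _ _

theorem adjT_mul_self (i : ℕ) (h : i + 1 < n) : adjT i h * adjT i h = 1 :=
  Equiv.swap_mul_self _ _

theorem adjT_inv (i : ℕ) (h : i + 1 < n) : (adjT i h)⁻¹ = adjT i h :=
  Equiv.swap_inv _ _

/-- An adjacent transposition preserves the order of every pair other than `(i, i+1)`. -/
theorem adjT_lt (i : ℕ) (h : i + 1 < n) {a b : Fin n} (hab : a < b)
    (hne : ¬((a : ℕ) = i ∧ (b : ℕ) = i + 1)) : adjT i h a < adjT i h b := by
  rw [Fin.lt_def] at *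
  rw [adjT_val, adjT_val]
  split_ifs <;> omega

theorem permLength_inv (w : Equiv.Perm (Fin n)) : permLength w⁻¹ = permLength w := by
  unfold permLength
  refine Finset.card_bij' (fun p _ => (w⁻¹ p.2, w⁻¹ p.1)) (fun p _ => (w p.2, w p.1)) ?_ ?_ ?_ ?_
    <;> simp +contextual

theorem permLength_mul_adjT (w : Equiv.Perm (Fin n)) (i : ℕ) (h : i + 1 < n)
    (hw : w ⟨i, Nat.lt_of_succ_lt h⟩ < w ⟨i + 1, h⟩) :
    permLength (w * adjT i h) = permLength w + 1 := by
  unfold permLength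
  set a₀ : Fin n := ⟨i, Nat.lt_of_succ_lt h⟩
  set b₀ : Fin n := ⟨i + 1, h⟩
  have hmem : (a₀, b₀) ∈ Finset.univ.filter (fun p : Fin n × Fin n =>
      p.1 < p.2 ∧ (w * adjT i h) p.2 < (w * adjT i h) p.1) := by
    rw [Finset.mem_filter]
    refine ⟨Finset.mem_univ _, Fin.lt_def.2 (Nat.lt_succ_self i), ?_⟩
    rw [Equiv.Perm.mul_apply, Equiv.Perm.mul_apply, adjT_left i h, adjT_right i h]
    exact hw
  rw [← Finset.card_erase_add_one hmem]
  congr 1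
  refine Finset.card_bij' (fun p _ => (adjT i h p.1, adjT i h p.2))
    (fun p _ => (adjT i h p.1, adjT i h p.2)) ?_ ?_ ?_ ?_
  · rintro ⟨a, b⟩ hp
    simp only [Finset.mem_erase, Finset.mem_filter, Finset.mem_univ, true_and, ne_eq,
      Prod.mk.injEq] at hp ⊢
    exact ⟨adjT_lt i h hp.2.1 fun hc => hp.1 ⟨Fin.ext hc.1, Fin.ext hc.2⟩, hp.2.2⟩
  · rintro ⟨a, b⟩ hp
    simp only [Finset.mem_erase, Finset.mem_filter, Finset.mem_univ, true_and, ne_eq,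
      Prod.mk.injEq] at hp ⊢
    refine ⟨?_, adjT_lt i h hp.1 ?_, by
      simpa only [Equiv.Perm.mul_apply, adjT_adjT] using hp.2⟩
    · rintro ⟨h1, h2⟩
      have h1' : a = b₀ := by rw [← adjT_adjT i h a, h1]; exact adjT_left i h
      have h2' : b = a₀ := by rw [← adjT_adjT i h b, h2]; exact adjT_right i h
      have := hp.1
      rw [h1', h2', Fin.lt_def] at this
      exact absurd this (by simp [a₀, b₀])
    · rintro ⟨h1, h2⟩
      have h1' : a = a₀ := Fin.ext h1
      have h2' : b = b₀ := Fin.ext h2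
      exact absurd hp.2 (by rw [h1', h2']; exact hw.asymm)
  · rintro ⟨a, b⟩ _
    simp [adjT_adjT]
  · rintro ⟨a, b⟩ _
    simp [adjT_adjT]

theorem permLength_mul_adjT_of_desc (w : Equiv.Perm (Fin n)) (i : ℕ) (h : i + 1 < n)
    (hw : w ⟨i + 1, h⟩ < w ⟨i, Nat.lt_of_succ_lt h⟩) :
    permLength w = permLength (w * adjT i h) + 1 := by
  rw [← permLength_mul_adjT (w * adjT i h) i h, mul_assoc, adjT_mul_self, mul_one]
  rw [Equiv.Perm.mul_apply, Equiv.Perm.mul_apply, adjT_left, adjT_right]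
  exact hw

/-- A function on `Fin n` which ascends at each step from `a` to `b` is larger at `b`. -/
theorem lt_of_forall_succ_lt {α : Type*} [Preorder α] (z : Fin n → α) {a b : Fin n} (hab : a < b)
    (hz : ∀ (k : ℕ) (h : k + 1 < n), (a : ℕ) ≤ k → k + 1 ≤ (b : ℕ) →
      z ⟨k, Nat.lt_of_succ_lt h⟩ < z ⟨k + 1, h⟩) : z a < z b := by
  have key : ∀ c, (a : ℕ) + 1 ≤ c → ∀ hc : c < n, c ≤ b → z a < z ⟨c, hc⟩ := by
    intro c hac
    induction c, hac using Nat.le_induction with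
    | base => exact fun hc hcb => hz a hc le_rfl hcb
    | succ c hac ih =>
      exact fun hc hcb => (ih (Nat.lt_of_succ_lt hc) (by omega)).trans (hz c hc (by omega) hcb)
  exact key b hab b.2 le_rfl

theorem perm_eq_one_of_strictMono {w : Equiv.Perm (Fin n)} (hw : StrictMono w) : w = 1 := by
  have : StrictMono.orderIsoOfSurjective w hw w.surjective = OrderIso.refl (Fin n) :=
    Subsingleton.elim _ _
  ext a
  exact congrArg (fun e : Fin n ≃o Fin n => ((e a : Fin n) : ℕ)) this

theorem exists_desc_of_ne_one {w : Equiv.Perm (Fin n)} (hw : w ≠ 1) :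
    ∃ (i : ℕ) (h : i + 1 < n), w ⟨i + 1, h⟩ < w ⟨i, Nat.lt_of_succ_lt h⟩ := by
  by_contra! hc
  refine hw (perm_eq_one_of_strictMono fun a b hab => ?_)
  refine lt_of_forall_succ_lt w hab fun k h _ _ => lt_of_le_of_ne (hc k h) fun he => ?_
  simpa using w.injective he

end Length

section Standard

variable {F : Type*} [Field F] {H : Type*} [Ring H] [Algebra F H] {n : ℕ}

/-- The standard basis reindexed by inverses, so that `X (v * u) = X v * X u` when
lengths add. -/
def invBasis (T : Equiv.Perm (Fin n) → H) (v : Equiv.Perm (Fin n)) : H := T v⁻¹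

variable {q : F} {T : Equiv.Perm (Fin n) → H}

theorem invBasis_one (hT : IsHeckeBasis q T) : invBasis T 1 = 1 := by
  rw [invBasis, inv_one, hT.one]

theorem invBasis_mul_adjT (hT : IsHeckeBasis q T) (v : Equiv.Perm (Fin n)) (i : ℕ)
    (h : i + 1 < n) (hv : v ⟨i, Nat.lt_of_succ_lt h⟩ < v ⟨i + 1, h⟩) :
    invBasis T v * invBasis T (adjT i h) = invBasis T (v * adjT i h) := by
  have e : adjT i h * v⁻¹ = (v * adjT i h)⁻¹ := by rw [mul_inv_rev, adjT_inv]
  unfold invBasis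
  rw [adjT_inv, hT.mul_adj_asc, e]
  rw [e, permLength_inv, permLength_inv, permLength_mul_adjT v i h hv]
  exact Nat.lt_succ_self _

theorem invBasis_adjT_sq (hT : IsHeckeBasis q T) (i : ℕ) (h : i + 1 < n) :
    invBasis T (adjT i h) * invBasis T (adjT i h)
      = q • (1 : H) + (q - 1) • invBasis T (adjT i h) := by
  unfold invBasis
  rw [adjT_inv, hT.mul_adj_desc, adjT_mul_self, hT.one]
  rw [adjT_mul_self, permLength_mul_adjT_of_desc (adjT i h) i h, adjT_mul_self]
  · exact Nat.lt_succ_self _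
  · rw [adjT_left, adjT_right]
    exact Fin.lt_def.2 (Nat.lt_succ_self i)

/-- The standard basis is multiplicative on pairs whose lengths add. -/
theorem invBasis_mul (hT : IsHeckeBasis q T) (v u : Equiv.Perm (Fin n))
    (hvu : ∀ a b, a < b → u b < u a → v (u b) < v (u a)) :
    invBasis T v * invBasis T u = invBasis T (v * u) := by
  induction hl : permLength u using Nat.strong_induction_on generalizing u with
  | _ l ih =>
    by_cases hu : u = 1
    · rw [hu, invBasis_one hT, mul_one, mul_one]
    obtain ⟨i, h, hi⟩ := exists_desc_of_ne_one hu
    set u' := u * adjT i h with hu'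
    have huu : u = u' * adjT i h := by rw [hu', mul_assoc, adjT_mul_self, mul_one]
    have hL : u' ⟨i, Nat.lt_of_succ_lt h⟩ = u ⟨i + 1, h⟩ := by
      rw [hu', Equiv.Perm.mul_apply, adjT_left]
    have hR : u' ⟨i + 1, h⟩ = u ⟨i, Nat.lt_of_succ_lt h⟩ := by
      rw [hu', Equiv.Perm.mul_apply, adjT_right]
    have hlt : permLength u' < l := by
      rw [← hl, permLength_mul_adjT_of_desc u i h hi]
      exact Nat.lt_succ_self _
    have hstep := ih _ hlt u' (fun a b hab hba => by
      by_cases hc : (a : ℕ) = i ∧ (b : ℕ) = i + 1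
      · have ha : a = ⟨i, Nat.lt_of_succ_lt h⟩ := Fin.ext hc.1
        have hb : b = ⟨i + 1, h⟩ := Fin.ext hc.2
        rw [ha, hb, hL, hR] at hba
        exact absurd hba hi.asymm
      · exact hvu _ _ (adjT_lt i h hab hc) hba) rfl
    rw [huu, ← invBasis_mul_adjT hT u' i h (by rw [hL, hR]; exact hi), ← mul_assoc, hstep,
      invBasis_mul_adjT hT (v * u') i h, mul_assoc]
    rw [Equiv.Perm.mul_apply v, Equiv.Perm.mul_apply v, hL, hR]
    exact hvu _ _ (Fin.lt_def.2 (Nat.lt_succ_self i)) hi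

theorem invBasis_adjT_mul (hT : IsHeckeBasis q T) (u : Equiv.Perm (Fin n)) (i : ℕ)
    (h : i + 1 < n) (hu : u⁻¹ ⟨i, Nat.lt_of_succ_lt h⟩ < u⁻¹ ⟨i + 1, h⟩) :
    invBasis T (adjT i h) * invBasis T u = invBasis T (adjT i h * u) := by
  refine invBasis_mul hT _ _ fun a b hab hba => adjT_lt i h hba ?_
  rintro ⟨h1, h2⟩
  have hb : u b = ⟨i, Nat.lt_of_succ_lt h⟩ := Fin.ext h1
  have ha : u a = ⟨i + 1, h⟩ := Fin.ext h2
  rw [← hb, ← ha, perm_inv_apply, perm_inv_apply] at hu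
  exact absurd hu hab.asymm

theorem span_range_invBasis (hT : IsHeckeBasis q T) :
    Submodule.span F (Set.range (invBasis T)) = ⊤ := by
  rw [← hT.total]
  congr 1
  exact (Equiv.inv (Equiv.Perm (Fin n))).surjective.range_comp T

/-- Pairing `v` with `v * (i, i+1)` in a sum over a set stable under this multiplication. -/
theorem sum_eq_sum_asc {M : Type*} [AddCommMonoid M] (P : Equiv.Perm (Fin n) → Prop) (i : ℕ)
    (h : i + 1 < n) (hP : ∀ v, P v → P (v * adjT i h)) (g : Equiv.Perm (Fin n) → M) :
    ∑ v with P v, g v = ∑ v with P v ∧ v ⟨i, Nat.lt_of_succ_lt h⟩ < v ⟨i + 1, h⟩,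
      (g v + g (v * adjT i h)) := by
  rw [Finset.sum_add_distrib, ← Finset.sum_filter_add_sum_filter_not (Finset.univ.filter P)
    (fun v => v ⟨i, Nat.lt_of_succ_lt h⟩ < v ⟨i + 1, h⟩), Finset.filter_filter,
    Finset.filter_filter]
  congr 1
  refine Finset.sum_bij' (fun v _ => v * adjT i h) (fun v _ => v * adjT i h) ?_ ?_ ?_ ?_ ?_
  · intro v hv
    simp only [Finset.mem_filter, Finset.mem_univ, true_and, Equiv.Perm.mul_apply, adjT_left,
      adjT_right, not_lt] at hv ⊢
    refine ⟨hP v hv.1, lt_of_le_of_ne hv.2 fun he => ?_⟩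
    simpa using v.injective he
  · intro v hv
    simp only [Finset.mem_filter, Finset.mem_univ, true_and, Equiv.Perm.mul_apply, adjT_left,
      adjT_right, not_lt] at hv ⊢
    exact ⟨hP v hv.1, hv.2.le⟩
  · intro v _
    simp [mul_assoc, adjT_mul_self]
  · intro v _
    simp [mul_assoc, adjT_mul_self]
  · intro v _
    simp [mul_assoc, adjT_mul_self]

end Standard

section Blocks

variable {n : ℕ}

/-- The permutations preserving the fibres of `blk`. -/
def Par (blk : Fin n → ℕ) (u : Equiv.Perm (Fin n)) : Prop := ∀ a, blk (u a) = blk a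

/-- The permutations increasing along the fibres of `blk`. -/
def Inc (blk : Fin n → ℕ) (v : Equiv.Perm (Fin n)) : Prop :=
  ∀ a b, a < b → blk a = blk b → v a < v b

theorem Par.mul {blk : Fin n → ℕ} {u w : Equiv.Perm (Fin n)} (hu : Par blk u) (hw : Par blk w) :
    Par blk (u * w) := fun a => (hu (w a)).trans (hw a)

theorem Par.inv {blk : Fin n → ℕ} {u : Equiv.Perm (Fin n)} (hu : Par blk u) : Par blk u⁻¹ :=
  fun a => by rw [← hu (u⁻¹ a), perm_apply_inv]

theorem par_adjT {blk : Fin n → ℕ} (i : ℕ) (h : i + 1 < n)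
    (hi : blk ⟨i, Nat.lt_of_succ_lt h⟩ = blk ⟨i + 1, h⟩) : Par blk (adjT i h) := by
  intro a
  by_cases h1 : a = ⟨i, Nat.lt_of_succ_lt h⟩
  · rw [h1, adjT_left, hi]
  by_cases h2 : a = ⟨i + 1, h⟩
  · rw [h2, adjT_right, hi]
  rw [adjT, Equiv.swap_apply_of_ne_of_ne h1 h2]

theorem eq_one_of_par_of_inc {blk : Fin n → ℕ} (hb : Monotone blk) {w : Equiv.Perm (Fin n)}
    (hp : Par blk w) (hi : Inc blk w) : w = 1 := by
  refine perm_eq_one_of_strictMono fun a b hab => ?_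
  rcases (hb hab.le).lt_or_eq with hlt | heq
  · by_contra hc
    have := hb (not_lt.1 hc)
    rw [hp, hp] at this
    omega
  · exact hi a b hab heq

theorem Inc.eq_of_mul {blk : Fin n → ℕ} (hb : Monotone blk) {v w : Equiv.Perm (Fin n)}
    (hv : Inc blk v) (hw : Par blk w) (hvw : Inc blk (v * w)) : w = 1 := by
  refine eq_one_of_par_of_inc hb hw fun a b hab he => ?_
  have h1 : v (w a) < v (w b) := hvw a b hab he
  have h2 : blk (w a) = blk (w b) := by rw [hw, hw, he]
  rcases lt_trichotomy (w a) (w b) with h | h | h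
  · exact h
  · rw [h] at h1
    exact absurd h1 (lt_irrefl _)
  · exact absurd h1 (hv _ _ h h2.symm).asymm

theorem exists_inc_mul_par {blk : Fin n → ℕ} (hb : Monotone blk) (u : Equiv.Perm (Fin n)) :
    ∃ v w, Inc blk v ∧ Par blk w ∧ u = v * w := by
  set g : Fin n → ℕ ×ₗ Fin n := fun a => toLex (blk a, u a) with hg
  set σ := Tuple.sort g
  have hmono : Monotone (g ∘ σ) := Tuple.monotone_sort g
  have hle : ∀ a b, a ≤ b → blk (σ a) < blk (σ b) ∨ blk (σ a) = blk (σ b) ∧ u (σ a) ≤ u (σ b) :=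
    fun a b hab => Prod.Lex.toLex_le_toLex.1 (hmono hab)
  have hblk : blk ∘ σ = blk ∘ (1 : Equiv.Perm (Fin n)) := by
    refine Tuple.unique_monotone (fun a b hab => ?_) hb
    rcases hle a b hab with h | h
    · exact h.le
    · exact h.1.le
  have hσ : Par blk σ := fun a => congrFun hblk a
  refine ⟨u * σ, σ⁻¹, fun a b hab he => ?_, hσ.inv, by rw [mul_assoc, mul_inv_cancel, mul_one]⟩
  rcases hle a b hab.le with h | h
  · rw [hσ, hσ] at h
    exact absurd he h.ne
  · refine lt_of_le_of_ne h.2 fun hc => hab.ne ?_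
    exact (u * σ).injective hc

/-- Every permutation factors uniquely as one increasing on blocks times one preserving blocks. -/
theorem sum_eq_sum_inc_par {M : Type*} [AddCommMonoid M] {blk : Fin n → ℕ} (hb : Monotone blk)
    (P : Equiv.Perm (Fin n) → Prop) (hP : ∀ v u, Par blk u → P v → P (v * u))
    (g : Equiv.Perm (Fin n) → M) :
    ∑ v with P v, g v = ∑ v with P v ∧ Inc blk v, ∑ u with Par blk u, g (v * u) := by
  rw [← Finset.sum_product']
  symm
  refine Finset.sum_bij (fun p _ => p.1 * p.2) ?_ ?_ ?_ ?_
  · rintro ⟨v, u⟩ h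
    simp only [Finset.mem_product, Finset.mem_filter, Finset.mem_univ, true_and] at h ⊢
    exact hP v u h.2 h.1.1
  · rintro ⟨v, u⟩ h ⟨v', u'⟩ h' he
    simp only [Finset.mem_product, Finset.mem_filter, Finset.mem_univ, true_and] at h h' he
    have hv : v' = v * (u * u'⁻¹) := by rw [← mul_assoc, he, mul_assoc, mul_inv_cancel, mul_one]
    have h1 := Inc.eq_of_mul hb h.1.2 (h.2.mul h'.2.inv) (hv ▸ h'.1.2)
    rw [h1, mul_one] at hv
    rw [mul_inv_eq_one] at h1
    rw [hv, h1]
  · intro w hw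
    simp only [Finset.mem_filter, Finset.mem_univ, true_and] at hw
    obtain ⟨v, u, hv, hu, rfl⟩ := exists_inc_mul_par hb w
    refine ⟨(v, u), ?_, rfl⟩
    simp only [Finset.mem_product, Finset.mem_filter, Finset.mem_univ, true_and]
    refine ⟨⟨?_, hv⟩, hu⟩
    have := hP _ _ hu.inv hw
    rwa [mul_assoc, mul_inv_cancel, mul_one] at this
  · intro p _
    rfl

end Blocks

section ParabolicSums

variable {F : Type*} [Field F] {H : Type*} [Ring H] [Algebra F H] {n : ℕ}
  {q : F} {T : Equiv.Perm (Fin n) → H}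

/-- The sum of the basis elements over the parabolic subgroup attached to `blk`. -/
def parSum (T : Equiv.Perm (Fin n) → H) (blk : Fin n → ℕ) : H :=
  ∑ u with Par blk u, invBasis T u

theorem invBasis_mul_of_inc_of_par (hT : IsHeckeBasis q T) {blk : Fin n → ℕ} (hb : Monotone blk)
    {v u : Equiv.Perm (Fin n)} (hv : Inc blk v) (hu : Par blk u) :
    invBasis T v * invBasis T u = invBasis T (v * u) := by
  refine invBasis_mul hT _ _ fun a b hab hba => hv _ _ hba ?_
  have h1 := hb hab.le
  have h2 := hb hba.le
  rw [hu, hu] at h2 ⊢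
  omega

theorem invBasis_mul_of_par_of_inv_inc (hT : IsHeckeBasis q T) {blk : Fin n → ℕ}
    (hb : Monotone blk) {v u : Equiv.Perm (Fin n)} (hv : Inc blk v) (hu : Par blk u) :
    invBasis T u⁻¹ * invBasis T v⁻¹ = invBasis T (v * u)⁻¹ := by
  rw [mul_inv_rev]
  refine invBasis_mul hT _ _ fun a b hab hba => ?_
  have hne : blk (v⁻¹ b) ≠ blk (v⁻¹ a) := fun he => by
    have := hv _ _ hba he
    rw [perm_apply_inv, perm_apply_inv] at this
    exact absurd this hab.asymm
  have hlt := lt_of_le_of_ne (hb hba.le) hne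
  by_contra hc
  have := hb (not_lt.1 hc)
  rw [hu.inv, hu.inv] at this
  omega

theorem sum_eq_sum_inc_mul_parSum (hT : IsHeckeBasis q T) {blk : Fin n → ℕ} (hb : Monotone blk)
    (P : Equiv.Perm (Fin n) → Prop) (hP : ∀ v u, Par blk u → P v → P (v * u)) :
    ∑ v with P v, invBasis T v = (∑ v with P v ∧ Inc blk v, invBasis T v) * parSum T blk := by
  rw [sum_eq_sum_inc_par hb P hP, parSum, Finset.sum_mul_sum]
  refine Finset.sum_congr rfl fun v hv => Finset.sum_congr rfl fun u hu => ?_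
  simp only [Finset.mem_filter, Finset.mem_univ, true_and] at hv hu
  exact (invBasis_mul_of_inc_of_par hT hb hv.2 hu).symm

theorem sum_inv_of_inv_mem {M : Type*} [AddCommMonoid M] (P : Equiv.Perm (Fin n) → Prop)
    (hP : ∀ v, P v → P v⁻¹) (g : Equiv.Perm (Fin n) → M) :
    ∑ u with P u, g u = ∑ u with P u, g u⁻¹ := by
  refine Finset.sum_bij' (fun v _ => v⁻¹) (fun v _ => v⁻¹) ?_ ?_ ?_ ?_ ?_
    <;> simp +contextual [hP]

/-- The symmetrizer of a coarse parabolic subgroup is a right multiple of the symmetrizer of a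
finer one. -/
theorem exists_parSum_eq_parSum_mul (hT : IsHeckeBasis q T) {fine coarse : Fin n → ℕ}
    (hf : Monotone fine) (hfc : ∀ u, Par fine u → Par coarse u) :
    ∃ D : H, parSum T coarse = parSum T fine * D := by
  refine ⟨∑ v with Par coarse v ∧ Inc fine v, invBasis T v⁻¹, ?_⟩
  rw [parSum, sum_inv_of_inv_mem _ fun v hv => hv.inv,
    sum_eq_sum_inc_par hf (Par coarse) fun v u hu hv => hv.mul (hfc u hu), parSum,
    sum_inv_of_inv_mem (Par fine) fun v hv => hv.inv, Finset.sum_mul_sum, Finset.sum_comm]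
  refine Finset.sum_congr rfl fun u hu => Finset.sum_congr rfl fun v hv => ?_
  simp only [Finset.mem_filter, Finset.mem_univ, true_and] at hv hu
  exact (invBasis_mul_of_par_of_inv_inc hT hf hv.2 hu).symm

theorem invBasis_adjT_mul_one_add (hT : IsHeckeBasis q T) (i : ℕ) (h : i + 1 < n) :
    (1 + invBasis T (adjT i h)) * invBasis T (adjT i h) = q • (1 + invBasis T (adjT i h)) := by
  rw [add_mul, one_mul, invBasis_adjT_sq hT, sub_smul, one_smul, smul_add]
  abel

theorem one_add_mul_invBasis_adjT (hT : IsHeckeBasis q T) (i : ℕ) (h : i + 1 < n) :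
    invBasis T (adjT i h) * (1 + invBasis T (adjT i h)) = q • (1 + invBasis T (adjT i h)) := by
  rw [← invBasis_adjT_mul_one_add hT, mul_add, add_mul, one_mul, mul_one]

/-- A sum over a set stable under right multiplication by `(i, i+1)` is a left multiple of
`1 + T_i`. -/
theorem exists_sum_eq_mul_one_add (hT : IsHeckeBasis q T) (P : Equiv.Perm (Fin n) → Prop) (i : ℕ)
    (h : i + 1 < n) (hP : ∀ v, P v → P (v * adjT i h)) :
    ∃ g : H, ∑ v with P v, invBasis T v = g * (1 + invBasis T (adjT i h)) := by
  refine ⟨∑ v with P v ∧ v ⟨i, Nat.lt_of_succ_lt h⟩ < v ⟨i + 1, h⟩, invBasis T v, ?_⟩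
  rw [sum_eq_sum_asc P i h hP, Finset.sum_mul]
  refine Finset.sum_congr rfl fun v hv => ?_
  rw [mul_add, mul_one, invBasis_mul_adjT hT v i h (Finset.mem_filter.1 hv).2.2]

theorem sum_inv_par_asc {M : Type*} [AddCommMonoid M] {blk : Fin n → ℕ} (i : ℕ) (h : i + 1 < n)
    (hi : blk ⟨i, Nat.lt_of_succ_lt h⟩ = blk ⟨i + 1, h⟩) (g : Equiv.Perm (Fin n) → M) :
    ∑ u with Par blk u, g u = ∑ u with Par blk u ∧ u ⟨i, Nat.lt_of_succ_lt h⟩ < u ⟨i + 1, h⟩,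
      (g u⁻¹ + g (adjT i h * u⁻¹)) := by
  rw [sum_inv_of_inv_mem _ fun v hv => hv.inv,
    sum_eq_sum_asc (Par blk) i h fun v hv => hv.mul (par_adjT i h hi)]
  simp only [mul_inv_rev, adjT_inv]

theorem invBasis_adjT_mul_parSum (hT : IsHeckeBasis q T) {blk : Fin n → ℕ} (i : ℕ) (h : i + 1 < n)
    (hi : blk ⟨i, Nat.lt_of_succ_lt h⟩ = blk ⟨i + 1, h⟩) :
    invBasis T (adjT i h) * parSum T blk = q • parSum T blk := by
  rw [parSum, sum_inv_par_asc i h hi, Finset.mul_sum, Finset.smul_sum]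
  refine Finset.sum_congr rfl fun u hu => ?_
  have hu' := (Finset.mem_filter.1 hu).2.2
  rw [← invBasis_adjT_mul hT u⁻¹ i h (by rwa [inv_inv])]
  conv_lhs => rw [← one_add_mul, ← mul_assoc, one_add_mul_invBasis_adjT hT]
  rw [smul_mul_assoc, one_add_mul]

theorem invBasis_mul_parSum (hT : IsHeckeBasis q T) {blk : Fin n → ℕ} (hb : Monotone blk)
    {w : Equiv.Perm (Fin n)} (hw : Par blk w) :
    invBasis T w * parSum T blk = q ^ permLength w • parSum T blk := by
  induction hl : permLength w using Nat.strong_induction_on generalizing w with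
  | _ l ih =>
    by_cases h1 : w = 1
    · have h0 : l = 0 := by
        rw [← hl, h1, permLength, Finset.card_eq_zero, Finset.filter_eq_empty_iff]
        exact fun p _ hp => hp.1.asymm hp.2
      rw [h1, h0, invBasis_one hT, one_mul, pow_zero, one_smul]
    obtain ⟨i, h, hi⟩ := exists_desc_of_ne_one h1
    have hblk : blk ⟨i, Nat.lt_of_succ_lt h⟩ = blk ⟨i + 1, h⟩ := by
      refine le_antisymm (hb (Fin.le_def.2 (Nat.le_succ i))) ?_
      rw [← hw, ← hw ⟨i, _⟩]
      exact hb hi.le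
    have hlen := permLength_mul_adjT_of_desc w i h hi
    have hww : invBasis T w = invBasis T (w * adjT i h) * invBasis T (adjT i h) := by
      rw [invBasis_mul_adjT hT, mul_assoc, adjT_mul_self, mul_one]
      rw [Equiv.Perm.mul_apply, Equiv.Perm.mul_apply, adjT_left, adjT_right]
      exact hi
    rw [hww, mul_assoc, invBasis_adjT_mul_parSum hT i h hblk, mul_smul_comm,
      ih _ (by omega) (hw.mul (par_adjT i h hblk)) rfl, smul_smul, ← pow_succ', ← hlen, hl]

end ParabolicSums

section Vanishing

variable {F : Type*} [Field F] {H : Type*} [Ring H] [Algebra F H] {n : ℕ}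
  {q : F} {T : Equiv.Perm (Fin n) → H}

/-- The signed sum of the basis elements over the parabolic subgroup attached to `blk`. -/
def signedParSum (q : F) (T : Equiv.Perm (Fin n) → H) (blk : Fin n → ℕ) : H :=
  ∑ u with Par blk u, ((-q)⁻¹) ^ permLength u • invBasis T u

theorem one_add_mul_signedParSum (hT : IsHeckeBasis q T) (hq : q ≠ 0) {blk : Fin n → ℕ} (i : ℕ)
    (h : i + 1 < n) (hi : blk ⟨i, Nat.lt_of_succ_lt h⟩ = blk ⟨i + 1, h⟩) :
    (1 + invBasis T (adjT i h)) * signedParSum q T blk = 0 := by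
  rw [signedParSum, sum_inv_par_asc i h hi, Finset.mul_sum]
  refine Finset.sum_eq_zero fun u hu => ?_
  have hu' := (Finset.mem_filter.1 hu).2.2
  have hlen : permLength (adjT i h * u⁻¹) = permLength u⁻¹ + 1 := by
    rw [← permLength_inv, mul_inv_rev, adjT_inv, inv_inv, permLength_mul_adjT u i h hu',
      permLength_inv]
  rw [hlen, ← invBasis_adjT_mul hT u⁻¹ i h (by rwa [inv_inv]), pow_succ, mul_smul, ← smul_add,
    mul_smul_comm]
  have key : (1 + invBasis T (adjT i h)) * (1 + (-q)⁻¹ • invBasis T (adjT i h)) = 0 := by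
    rw [mul_add, mul_one, mul_smul_comm, invBasis_adjT_mul_one_add hT, smul_smul, inv_neg,
      neg_mul, inv_mul_cancel₀ hq, neg_smul, one_smul, add_neg_cancel]
  rw [← smul_mul_assoc (-q)⁻¹, ← one_add_mul, ← mul_assoc, key, zero_mul, smul_zero]

/-- If `G` is symmetric along an interval of positions longer than the number of blocks of
`blk`, then it is annihilated by the signed sum over the blocks. -/
theorem mul_mul_signedParSum_eq_zero (hT : IsHeckeBasis q T) (hq : q ≠ 0) {blk : Fin n → ℕ}
    (hb : Monotone blk) {m r s : ℕ} (hm : ∀ a, blk a < m) (hms : m < s) (hrs : r + s ≤ n) (G : H)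
    (hG : ∀ (i : ℕ) (h : i + 1 < n), r ≤ i → i + 1 < r + s →
      ∃ g : H, G = g * (1 + invBasis T (adjT i h))) (x : H) :
    G * x * signedParSum q T blk = 0 := by
  set y := signedParSum q T blk with hy
  suffices hbasis : ∀ w, G * invBasis T w * y = 0 by
    have hx : x ∈ Submodule.span F (Set.range (invBasis T)) := by
      rw [span_range_invBasis hT]
      trivial
    induction hx using Submodule.span_induction with
    | mem x hx =>
      obtain ⟨w, rfl⟩ := hx
      exact hbasis w
    | zero => rw [mul_zero, zero_mul]
    | add x z _ _ hx hz => rw [mul_add, add_mul, hx, hz, add_zero]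
    | smul c x _ hx => rw [mul_smul_comm, smul_mul_assoc, hx, smul_zero]
  intro w
  induction hl : permLength w using Nat.strong_induction_on generalizing w with
  | _ l ih =>
    by_cases hleft : ∃ (i : ℕ) (h : i + 1 < n), r ≤ i ∧ i + 1 < r + s ∧
        w⁻¹ ⟨i + 1, h⟩ < w⁻¹ ⟨i, Nat.lt_of_succ_lt h⟩
    · obtain ⟨i, h, hri, his, hi⟩ := hleft
      obtain ⟨g, hg⟩ := hG i h hri his
      have hlen : permLength w = permLength (adjT i h * w) + 1 := by
        rw [← permLength_inv w, permLength_mul_adjT_of_desc _ i h hi,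
          ← permLength_inv (adjT i h * w), mul_inv_rev, adjT_inv]
      have hw : invBasis T w = invBasis T (adjT i h) * invBasis T (adjT i h * w) := by
        rw [invBasis_adjT_mul hT, ← mul_assoc, adjT_mul_self, one_mul]
        rw [mul_inv_rev, adjT_inv, Equiv.Perm.mul_apply, Equiv.Perm.mul_apply, adjT_left,
          adjT_right]
        exact hi
      rw [hw, ← mul_assoc]
      conv_lhs => rw [hg, mul_assoc g, invBasis_adjT_mul_one_add hT, mul_smul_comm, ← hg]
      rw [smul_mul_assoc, smul_mul_assoc, ih _ (by omega) _ rfl, smul_zero]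
    by_cases hright : ∃ (i : ℕ) (h : i + 1 < n), blk ⟨i, Nat.lt_of_succ_lt h⟩ = blk ⟨i + 1, h⟩ ∧
        w ⟨i + 1, h⟩ < w ⟨i, Nat.lt_of_succ_lt h⟩
    · obtain ⟨i, h, hblk, hi⟩ := hright
      have hlen := permLength_mul_adjT_of_desc w i h hi
      have hw : invBasis T w = invBasis T (w * adjT i h) * invBasis T (adjT i h) := by
        rw [invBasis_mul_adjT hT, mul_assoc, adjT_mul_self, mul_one]
        rw [Equiv.Perm.mul_apply, Equiv.Perm.mul_apply, adjT_left, adjT_right]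
        exact hi
      have hneg : invBasis T (adjT i h) * y = -y := by
        have := one_add_mul_signedParSum hT hq i h hblk
        rw [one_add_mul, ← hy] at this
        exact eq_neg_of_add_eq_zero_right this
      rw [hw, ← mul_assoc, mul_assoc (G * _), hneg, mul_neg, ih _ (by omega) _ rfl, neg_zero]
    push Not at hleft hright
    have hleft' : ∀ (i : ℕ) (h : i + 1 < n), r ≤ i → i + 1 < r + s →
        w⁻¹ ⟨i, Nat.lt_of_succ_lt h⟩ < w⁻¹ ⟨i + 1, h⟩ := fun i h h1 h2 =>
      lt_of_le_of_ne (hleft i h h1 h2) fun he => by simpa using w⁻¹.injective he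
    have hright' : ∀ (i : ℕ) (h : i + 1 < n), blk ⟨i, Nat.lt_of_succ_lt h⟩ = blk ⟨i + 1, h⟩ →
        w ⟨i, Nat.lt_of_succ_lt h⟩ < w ⟨i + 1, h⟩ := fun i h h1 =>
      lt_of_le_of_ne (hright i h h1) fun he => by simpa using w.injective he
    obtain ⟨a, b, hab, hblk⟩ : ∃ a b : Fin s, a < b ∧
        blk (w⁻¹ ⟨r + a, by omega⟩) = blk (w⁻¹ ⟨r + b, by omega⟩) := by
      obtain ⟨a, b, hne, he⟩ := Fintype.exists_ne_map_eq_of_card_lt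
        (fun a : Fin s => (⟨blk (w⁻¹ ⟨r + a, by omega⟩), hm _⟩ : Fin m)) (by simpa using hms)
      rw [Fin.mk.injEq] at he
      rcases hne.lt_or_gt with h | h
      · exact ⟨a, b, h, he⟩
      · exact ⟨b, a, h, he.symm⟩
    have hab' : (a : ℕ) < b := hab
    have hbs := b.2
    obtain ⟨i, hi⟩ : ∃ i, i = r + (a : ℕ) := ⟨_, rfl⟩
    have h : i + 1 < n := by omega
    have hp := hleft' i h (by omega) (by omega)
    have hpb : w⁻¹ ⟨i + 1, h⟩ ≤ w⁻¹ ⟨r + b, by omega⟩ := by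
      rcases (show i + 1 ≤ r + b by omega).lt_or_eq with hlt | heq
      · exact (lt_of_forall_succ_lt (fun c => w⁻¹ c) (a := ⟨i + 1, h⟩) (b := ⟨r + b, by omega⟩) hlt
          fun k hk h1 h2 => hleft' k hk (by simp at h1; omega) (by simp at h2; omega)).le
      · exact le_of_eq (congrArg _ (Fin.ext heq))
    have hia : blk (w⁻¹ ⟨i, Nat.lt_of_succ_lt h⟩) = blk (w⁻¹ ⟨r + a, by omega⟩) := by
      congr 3
    have hsame : ∀ c, w⁻¹ ⟨i, Nat.lt_of_succ_lt h⟩ ≤ c → c ≤ w⁻¹ ⟨i + 1, h⟩ →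
        blk c = blk (w⁻¹ ⟨i, Nat.lt_of_succ_lt h⟩) := fun c h1 h2 => by
      refine le_antisymm ?_ (hb h1)
      rw [hia, hblk]
      exact hb (h2.trans hpb)
    obtain ⟨k, hk⟩ : ∃ k : ℕ, k = w⁻¹ ⟨i, Nat.lt_of_succ_lt h⟩ := ⟨_, rfl⟩
    have hk1 : k + 1 ≤ w⁻¹ ⟨i + 1, h⟩ := by
      rw [hk]
      exact hp
    have hkn : k + 1 < n := hk1.trans_lt (w⁻¹ ⟨i + 1, h⟩).2
    have hkk : (⟨k, Nat.lt_of_succ_lt hkn⟩ : Fin n) = w⁻¹ ⟨i, Nat.lt_of_succ_lt h⟩ := Fin.ext hk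
    have hbk : blk ⟨k, Nat.lt_of_succ_lt hkn⟩ = blk ⟨k + 1, hkn⟩ := by
      rw [hkk, hsame ⟨k + 1, hkn⟩ (Fin.le_def.2 (by simp only; omega)) (Fin.le_def.2 hk1)]
    have hwk : w ⟨k, Nat.lt_of_succ_lt hkn⟩ = ⟨i, Nat.lt_of_succ_lt h⟩ := by
      rw [hkk, perm_apply_inv]
    have hwk1 : w ⟨k + 1, hkn⟩ = ⟨i + 1, h⟩ := by
      rcases hk1.lt_or_eq with hlt | heq
      · exfalso
        have h1 := hright' k hkn hbk
        have h2 : w ⟨k + 1, hkn⟩ < w (w⁻¹ ⟨i + 1, h⟩) := by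
          refine lt_of_forall_succ_lt w hlt fun c hc h3 h4 => hright' c hc ?_
          simp only at h3
          rw [hsame ⟨c, _⟩ (Fin.le_def.2 (by simp only; omega)) (Fin.le_def.2 (by simp only; omega)),
            hsame ⟨c + 1, _⟩ (Fin.le_def.2 (by simp only; omega)) (Fin.le_def.2 h4)]
        rw [perm_apply_inv] at h2
        rw [hwk] at h1
        have h1' : i < (w ⟨k + 1, hkn⟩ : Fin n) := h1
        have h2' : ((w ⟨k + 1, hkn⟩ : Fin n) : ℕ) < i + 1 := h2
        omega
      · have : (⟨k + 1, hkn⟩ : Fin n) = w⁻¹ ⟨i + 1, h⟩ := Fin.ext heq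
        rw [this, perm_apply_inv]
    have hcomm : adjT i h * w = w * adjT k hkn := by
      rw [adjT, adjT, ← hwk, ← hwk1, Equiv.mul_swap_eq_swap_mul]
    obtain ⟨g, hg⟩ := hG i h (by omega) (by omega)
    rw [hg, mul_assoc g, one_add_mul, invBasis_adjT_mul hT w i h hp, hcomm,
      ← invBasis_mul_adjT hT w k hkn (hright' k hkn hbk), ← mul_one_add, mul_assoc, mul_assoc,
      one_add_mul_signedParSum hT hq k hkn hbk, mul_zero, mul_zero]

end Vanishing

section Gaussian

variable {F : Type*} [Field F] (q : F)

theorem qBinom_zero_right (a : ℕ) : qBinom q a 0 = 1 := by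
  cases a <;> rfl

theorem qBinom_succ_succ (a b : ℕ) :
    qBinom q (a + 1) (b + 1) = qBinom q a b + q ^ (b + 1) * qBinom q a (b + 1) := rfl

theorem qBinom_eq_zero_of_lt {a b : ℕ} (h : a < b) : qBinom q a b = 0 := by
  induction a generalizing b with
  | zero =>
    obtain ⟨b, rfl⟩ := Nat.exists_eq_succ_of_ne_zero h.ne'
    rfl
  | succ a ih =>
    obtain ⟨b, rfl⟩ := Nat.exists_eq_succ_of_ne_zero (Nat.ne_zero_of_lt h)
    rw [Nat.succ_eq_add_one, qBinom_succ_succ, ih (by omega), ih (by omega), mul_zero, add_zero]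

theorem qBinom_self (a : ℕ) : qBinom q a a = 1 := by
  induction a with
  | zero => rfl
  | succ a ih =>
    rw [qBinom_succ_succ, ih, qBinom_eq_zero_of_lt q (Nat.lt_succ_self a), mul_zero, add_zero]

/-- The second `q`-Pascal recurrence. -/
theorem qBinom_add_succ (a b : ℕ) :
    qBinom q (a + b + 1) (b + 1) = q ^ a * qBinom q (a + b) b + qBinom q (a + b) (b + 1) := by
  induction a generalizing b with
  | zero => simp [qBinom_self, qBinom_eq_zero_of_lt]
  | succ a iha =>
    induction b with
    | zero =>
      have h := iha 0
      simp only [zero_add, add_zero, qBinom_zero_right, mul_one] at h ⊢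
      rw [qBinom_succ_succ, qBinom_zero_right]
      conv_lhs => rw [h]
      rw [qBinom_succ_succ q a 0, qBinom_zero_right]
      ring
    | succ b ihb =>
      have h1 : qBinom q (a + 1 + (b + 1)) (b + 1)
          = q ^ (a + 1) * qBinom q (a + 1 + b) b + qBinom q (a + 1 + b) (b + 1) := ihb
      have h2 : qBinom q (a + 1 + (b + 1)) (b + 2)
          = q ^ a * qBinom q (a + (b + 1)) (b + 1) + qBinom q (a + (b + 1)) (b + 2) := by
        rw [← iha (b + 1)]
        congr 1
        omega
      have h3 : qBinom q (a + 1 + (b + 1)) (b + 1)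
          = qBinom q (a + 1 + b) b + q ^ (b + 1) * qBinom q (a + 1 + b) (b + 1) :=
        qBinom_succ_succ q _ _
      have h4 : qBinom q (a + 1 + (b + 1)) (b + 2)
          = qBinom q (a + 1 + b) (b + 1) + q ^ (b + 2) * qBinom q (a + 1 + b) (b + 2) :=
        qBinom_succ_succ q _ _
      have h5 : a + (b + 1) = a + 1 + b := by omega
      rw [h5] at h2
      rw [qBinom_succ_succ]
      show qBinom q (a + 1 + (b + 1)) (b + 1) + q ^ (b + 2) * qBinom q (a + 1 + (b + 1)) (b + 2)
        = q ^ (a + 1) * qBinom q (a + 1 + (b + 1)) (b + 1) + qBinom q (a + 1 + (b + 1)) (b + 2)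
      linear_combination h1 + q ^ (b + 2) * h2 - q ^ (a + 1) * h3 - h4

theorem qBinom_symm (a b : ℕ) : qBinom q (a + b) a = qBinom q (a + b) b := by
  induction hn : a + b generalizing a b with
  | zero =>
    rw [show a = 0 by omega, show b = 0 by omega]
  | succ n ih =>
    rcases a with _ | a
    · rw [qBinom_zero_right, ← hn, zero_add, qBinom_self]
    rcases b with _ | b
    · rw [qBinom_zero_right, ← hn, add_zero, qBinom_self]
    have hb := qBinom_add_succ q (a + 1) b
    rw [show a + 1 + b + 1 = n + 1 by omega, show a + 1 + b = n by omega] at hb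
    rw [qBinom_succ_succ, hb, ih a (b + 1) (by omega), ih (a + 1) b (by omega)]
    ring

theorem qBinomProd_eq_prod (A B : Multiset ℕ) (s : Finset ℕ) (hs : (A + B).toFinset ⊆ s) :
    qBinomProd q A B = ∏ i ∈ s, qBinom q ((A + B).count i) (A.count i) := by
  refine Finset.prod_subset hs fun i _ hi => ?_
  rw [Multiset.mem_toFinset, ← Multiset.count_eq_zero, Multiset.count_add] at hi
  rw [Multiset.count_add, hi, show A.count i = 0 by omega, qBinom_zero_right]

theorem qBinomProd_comm (A B : Multiset ℕ) : qBinomProd q A B = qBinomProd q B A := by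
  unfold qBinomProd
  rw [add_comm]
  refine Finset.prod_congr rfl fun i _ => ?_
  rw [Multiset.count_add, add_comm, qBinom_symm]

theorem qBinomProd_eq_mul_filter (A B : Multiset ℕ) (k : ℕ) :
    qBinomProd q A B = qBinom q (A.count k + B.count k) (A.count k) *
      qBinomProd q (A.filter (· ≠ k)) (B.filter (· ≠ k)) := by
  have hs : ((A.filter (· ≠ k)) + (B.filter (· ≠ k))).toFinset
      ⊆ (insert k (A + B).toFinset).erase k := by
    intro i hi
    simp only [Multiset.mem_toFinset, Multiset.mem_add, Multiset.mem_filter, Finset.mem_erase,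
      Finset.mem_insert] at hi ⊢
    tauto
  rw [qBinomProd_eq_prod q A B _ (Finset.subset_insert k _), qBinomProd_eq_prod q _ _ _ hs,
    ← Finset.mul_prod_erase _ _ (Finset.mem_insert_self k _), Multiset.count_add]
  congr 1
  refine Finset.prod_congr rfl fun i hi => ?_
  have hik := Finset.ne_of_mem_erase hi
  rw [Multiset.count_add, Multiset.count_add, Multiset.count_filter_of_pos (p := (· ≠ k)) hik,
    Multiset.count_filter_of_pos (p := (· ≠ k)) hik]

theorem invPairs_cons_left (x : ℕ) (A B : Multiset ℕ) :
    invPairs (x ::ₘ A) B = (B.filter (· < x)).card + invPairs A B := by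
  unfold invPairs
  rw [Multiset.product, Multiset.cons_bind, Multiset.filter_add, Multiset.card_add]
  congr 1
  rw [Multiset.filter_map, Multiset.card_map]
  rfl

theorem invPairs_zero_left (B : Multiset ℕ) : invPairs 0 B = 0 := rfl

theorem invPairs_eq_filter {A B : Multiset ℕ} {k : ℕ} (hA : ∀ x ∈ A, x ≤ k) (hB : ∀ x ∈ B, x ≤ k) :
    invPairs A B = invPairs (A.filter (· ≠ k)) (B.filter (· ≠ k))
      + A.count k * (B.filter (· ≠ k)).card := by
  induction A using Multiset.induction with
  | empty => simp [invPairs_zero_left]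
  | cons x A ih =>
    have hx := hA x (Multiset.mem_cons_self x A)
    rw [invPairs_cons_left, ih fun y hy => hA y (Multiset.mem_cons_of_mem hy)]
    by_cases hk : x = k
    · subst hk
      have : B.filter (· < x) = B.filter (· ≠ x) :=
        Multiset.filter_congr fun y hy => ⟨fun h => h.ne, fun h => lt_of_le_of_ne (hB y hy) h⟩
      rw [this, Multiset.filter_cons_of_neg _ (by simp), Multiset.count_cons_self]
      ring
    · have : B.filter (· < x) = (B.filter (· ≠ k)).filter (· < x) := by
        rw [Multiset.filter_filter]
        refine Multiset.filter_congr fun y _ => ⟨fun h => ⟨h, ?_⟩, fun h => h.1⟩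
        omega
      rw [this, Multiset.filter_cons_of_pos (p := (· ≠ k)) _ hk, invPairs_cons_left,
        Multiset.count_cons_of_ne (Ne.symm hk)]
      ring

/-- The Garnir weight of the pair `(A, B)`. -/
def garnirWeight (A B : Multiset ℕ) : F := qBinomProd q A B * q ^ invPairs A B

theorem garnirWeight_eq_filter {A B : Multiset ℕ} {k : ℕ} (hA : ∀ x ∈ A, x ≤ k)
    (hB : ∀ x ∈ B, x ≤ k) :
    garnirWeight q A B = qBinom q (A.count k + B.count k) (A.count k)
      * q ^ (A.count k * (B.filter (· ≠ k)).card)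
      * garnirWeight q (A.filter (· ≠ k)) (B.filter (· ≠ k)) := by
  rw [garnirWeight, garnirWeight, qBinomProd_eq_mul_filter q A B k, invPairs_eq_filter hA hB,
    pow_add]
  ring

theorem garnirWeight_eq_of_erase {A B : Multiset ℕ} {k : ℕ} (hA : ∀ x ∈ A, x ≤ k)
    (hB : ∀ x ∈ B, x ≤ k) (hk : k ∈ A ∨ k ∈ B) :
    garnirWeight q A B = (if k ∈ B then garnirWeight q A (B.erase k) else 0)
      + (if k ∈ A then q ^ B.card * garnirWeight q (A.erase k) B else 0) := by
  have hfe : ∀ C : Multiset ℕ, (C.erase k).filter (· ≠ k) = C.filter (· ≠ k) := fun C => by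
    ext i
    by_cases hik : i = k
    · rw [Multiset.count_filter_of_neg (p := (· ≠ k)) (not_not.2 hik),
        Multiset.count_filter_of_neg (p := (· ≠ k)) (not_not.2 hik)]
    · rw [Multiset.count_filter_of_pos (p := (· ≠ k)) hik,
        Multiset.count_filter_of_pos (p := (· ≠ k)) hik, Multiset.count_erase_of_ne hik]
  have hcard : B.card = B.count k + (B.filter (· ≠ k)).card := by
    conv_lhs => rw [← Multiset.filter_add_not (· = k) B]
    rw [Multiset.card_add, Multiset.filter_eq' B k, Multiset.card_replicate]
  have hA' : ∀ x ∈ A.erase k, x ≤ k := fun x hx => hA x (Multiset.mem_of_mem_erase hx)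
  have hB' : ∀ x ∈ B.erase k, x ≤ k := fun x hx => hB x (Multiset.mem_of_mem_erase hx)
  rw [garnirWeight_eq_filter q hA hB, garnirWeight_eq_filter q hA hB',
    garnirWeight_eq_filter q hA' hB, hfe, hfe, hcard]
  simp only [Multiset.count_erase_self, ← Multiset.count_pos]
  generalize (B.filter (· ≠ k)).card = u
  generalize garnirWeight q (A.filter (· ≠ k)) (B.filter (· ≠ k)) = c
  have hk' : 0 < A.count k ∨ 0 < B.count k := by simpa only [Multiset.count_pos] using hk
  revert hk'
  generalize A.count k = a
  generalize B.count k = b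
  intro hk'
  rcases a with _ | a
  · rcases b with _ | b
    · simp at hk'
    · simp [qBinom_zero_right]
  · rcases b with _ | b
    · simp [qBinom_self]
      ring
    · have h := qBinom_add_succ q (b + 1) a
      have e1 : a + 1 + (b + 1) = b + 1 + a + 1 := by omega
      have e2 : a + 1 + b = b + 1 + a := by omega
      have e3 : a + (b + 1) = b + 1 + a := by omega
      simp only [Nat.add_sub_cancel, Nat.succ_pos, if_true, e1, e2, e3, h]
      ring

end Gaussian

section Counting

variable {F : Type*} [Field F] (q : F) {ι : Type*} [LinearOrder ι]

/-- The number of pairs `(x, y) ∈ I × J` with `y < x`. -/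
def invCount (I J : Finset ι) : ℕ := ((I ×ˢ J).filter fun p => p.2 < p.1).card

theorem invCount_eq_sum (I J : Finset ι) : invCount I J = ∑ x ∈ I, (J.filter (· < x)).card := by
  simp only [invCount, Finset.card_filter, Finset.sum_product]

theorem invCount_insert_right {I J : Finset ι} {a : ι} (hI : ∀ x ∈ I, x < a) :
    invCount I (insert a J) = invCount I J := by
  rw [invCount_eq_sum, invCount_eq_sum]
  refine Finset.sum_congr rfl fun x hx => ?_
  rw [Finset.filter_insert, if_neg (hI x hx).not_gt]

theorem invCount_insert_left {I J : Finset ι} {a : ι} (ha : a ∉ I) (hJ : ∀ x ∈ J, x < a) :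
    invCount (insert a I) J = J.card + invCount I J := by
  rw [invCount_eq_sum, Finset.sum_insert ha, Finset.filter_true_of_mem hJ, ← invCount_eq_sum]

/-- The inversion enumerator of the subsets with content `R` of the positions of a weakly
increasing word with content `R + U`. -/
theorem sum_pow_invCount (f : ι → ℕ) (s : Finset ι) (hf : ∀ x ∈ s, ∀ y ∈ s, x ≤ y → f x ≤ f y)
    (R U : Multiset ℕ) (hs : s.val.map f = R + U) :
    ∑ I ∈ s.powerset, (if I.val.map f = R then q ^ invCount I (s \ I) else 0)
      = garnirWeight q R U := by
  induction s using Finset.induction_on_max generalizing R U with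
  | empty =>
    have h : R + U = 0 := by simpa using hs.symm
    obtain ⟨rfl, rfl⟩ : R = 0 ∧ U = 0 := by simpa using h
    simp [garnirWeight, qBinomProd, invCount, invPairs_zero_left]
  | insert a s has ih =>
    have ha : a ∉ s := fun h => lt_irrefl _ (has a h)
    have hf' : ∀ x ∈ s, ∀ y ∈ s, x ≤ y → f x ≤ f y := fun x hx y hy =>
      hf x (Finset.mem_insert_of_mem hx) y (Finset.mem_insert_of_mem hy)
    rw [Finset.insert_val_of_notMem ha, Multiset.map_cons] at hs
    have hmax : ∀ x ∈ R + U, x ≤ f a := by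
      intro x hx
      rw [← hs, Multiset.mem_cons, Multiset.mem_map] at hx
      rcases hx with rfl | ⟨y, hy, rfl⟩
      · exact le_rfl
      · exact hf y (Finset.mem_insert_of_mem hy) a (Finset.mem_insert_self a s) (has y hy).le
    have hmem : f a ∈ R ∨ f a ∈ U := by
      rw [← Multiset.mem_add, ← hs]
      exact Multiset.mem_cons_self _ _
    rw [garnirWeight_eq_of_erase q (fun x hx => hmax x (Multiset.mem_add.2 (Or.inl hx)))
      (fun x hx => hmax x (Multiset.mem_add.2 (Or.inr hx))) hmem, Finset.sum_powerset_insert ha]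
    congr 1
    · have hterm : ∀ I ∈ s.powerset,
          (if I.val.map f = R then q ^ invCount I (insert a s \ I) else 0)
            = if I.val.map f = R then q ^ invCount I (s \ I) else 0 := by
        intro I hI
        rw [Finset.mem_powerset] at hI
        rw [Finset.insert_sdiff_of_notMem _ fun h => ha (hI h),
          invCount_insert_right fun x hx => has x (hI hx)]
      rw [Finset.sum_congr rfl hterm]
      split_ifs with hU
      · refine ih hf' R (U.erase (f a)) ?_
        obtain ⟨V, rfl⟩ := Multiset.exists_cons_of_mem hU
        rw [Multiset.erase_cons_head]
        rw [Multiset.add_cons] at hs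
        exact (Multiset.cons_inj_right _).1 hs
      · refine Finset.sum_eq_zero fun I hI => if_neg fun hc => ?_
        rw [Finset.mem_powerset, ← Finset.val_le_iff] at hI
        have h1 := Multiset.count_le_of_le (f a) (Multiset.map_le_map (f := f) hI)
        have h2 := congrArg (Multiset.count (f a)) hs
        rw [Multiset.count_cons_self, Multiset.count_add, Multiset.count_eq_zero.2 hU] at h2
        rw [hc] at h1
        omega
    · have hterm : ∀ I ∈ s.powerset,
          (if (insert a I).val.map f = R then
              q ^ invCount (insert a I) (insert a s \ insert a I) else 0)
            = if f a ∈ R then q ^ U.card *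
              (if I.val.map f = R.erase (f a) then q ^ invCount I (s \ I) else 0) else 0 := by
        intro I hI
        rw [Finset.mem_powerset] at hI
        have haI : a ∉ I := fun h => ha (hI h)
        have hsd : insert a s \ insert a I = s \ I := by
          rw [Finset.insert_sdiff_insert, Finset.sdiff_insert_of_notMem ha]
        rw [Finset.insert_val_of_notMem haI, Multiset.map_cons, hsd]
        by_cases hR : f a ∈ R
        · obtain ⟨R', rfl⟩ := Multiset.exists_cons_of_mem hR
          rw [if_pos hR, Multiset.erase_cons_head]
          simp only [Multiset.cons_inj_right]
          split_ifs with hc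
          · have hcard : (s \ I).card = U.card := by
              rw [Multiset.cons_add, Multiset.cons_inj_right, ← hc] at hs
              have := congrArg Multiset.card hs
              rw [Multiset.card_add, Multiset.card_map, Multiset.card_map] at this
              rw [Finset.card_sdiff_of_subset hI]
              change s.card = I.card + _ at this
              omega
            rw [invCount_insert_left haI fun x hx => has x (Finset.mem_sdiff.1 hx).1, pow_add,
              hcard]
          · rw [mul_zero]
        · rw [if_neg hR, if_neg]
          rintro rfl
          exact hR (Multiset.mem_cons_self _ _)
      rw [Finset.sum_congr rfl hterm]
      split_ifs with hR
      · rw [← Finset.mul_sum, ih hf' (R.erase (f a)) U]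
        obtain ⟨R', rfl⟩ := Multiset.exists_cons_of_mem hR
        rw [Multiset.erase_cons_head]
        rw [Multiset.cons_add] at hs
        exact (Multiset.cons_inj_right _).1 hs
      · exact Finset.sum_const_zero

end Counting

section Words

variable {n : ℕ}

theorem exists_perm_of_card_fiber_eq {α β : Type*} [Fintype α] [DecidableEq β] (a b : α → β)
    (h : ∀ c, (Finset.univ.filter (a · = c)).card = (Finset.univ.filter (b · = c)).card) :
    ∃ σ : Equiv.Perm α, ∀ x, b (σ x) = a x := by
  have e : ∀ c, Nonempty ({x // a x = c} ≃ {x // b x = c}) := fun c =>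
    ⟨Fintype.equivOfCardEq (by rw [Fintype.card_subtype, Fintype.card_subtype, h c])⟩
  exact ⟨Equiv.ofFiberEquiv fun c => (e c).some, fun x => Equiv.ofFiberEquiv_map _ x⟩

/-- The positions in the block `k`. -/
def fib (blk : Fin n → ℕ) (k : ℕ) : Finset (Fin n) := Finset.univ.filter (blk · = k)

theorem mem_fib {blk : Fin n → ℕ} {k : ℕ} {a : Fin n} : a ∈ fib blk k ↔ blk a = k := by
  simp [fib]

/-- The coarsening of a block function which merges the blocks `2k` and `2k + 1`. -/
def half (blk : Fin n → ℕ) : Fin n → ℕ := fun a => blk a / 2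

theorem Par.half {blk : Fin n → ℕ} {u : Equiv.Perm (Fin n)} (hu : Par blk u) :
    Par (half blk) u := fun a => congrArg (· / 2) (hu a)

theorem monotone_half {blk : Fin n → ℕ} (hb : Monotone blk) : Monotone (half blk) :=
  fun _ _ h => Nat.div_le_div_right (hb h)

/-- The multiset of letters of the word `g` at the positions in `s`. -/
def content (g : Fin n → ℕ) (s : Finset (Fin n)) : Multiset ℕ := s.val.map g

theorem card_content (g : Fin n → ℕ) (s : Finset (Fin n)) : (content g s).card = s.card :=
  Multiset.card_map _ _

theorem content_eq_add_sdiff (g : Fin n → ℕ) {I s : Finset (Fin n)} (h : I ⊆ s) :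
    content g s = content g I + content g (s \ I) := by
  rw [content, content, content, ← Multiset.map_add, ← Finset.disjUnion_val I (s \ I)
    Finset.disjoint_sdiff, Finset.disjUnion_eq_union, Finset.union_sdiff_of_subset h]

theorem content_comp_perm (g : Fin n → ℕ) (blk : Fin n → ℕ) (w : Equiv.Perm (Fin n)) (k : ℕ) :
    content (g ∘ w) (fib blk k) = content g (fib (blk ∘ ⇑w⁻¹) k) := by
  have h : fib (blk ∘ ⇑w⁻¹) k = (fib blk k).map w.toEmbedding := by
    ext a
    rw [mem_fib, Finset.mem_map]
    constructor
    · intro ha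
      exact ⟨w⁻¹ a, mem_fib.2 ha, perm_apply_inv w a⟩
    · rintro ⟨b, hb, rfl⟩
      change blk (w⁻¹ (w b)) = k
      rw [perm_inv_apply, mem_fib.1 hb]
  rw [h, content, content, Finset.map_val, Multiset.map_map]
  rfl

theorem content_comp_par (g : Fin n → ℕ) {blk : Fin n → ℕ} {w : Equiv.Perm (Fin n)}
    (hw : Par blk w) (k : ℕ) : content (g ∘ w) (fib blk k) = content g (fib blk k) := by
  rw [content_comp_perm]
  congr 1
  ext a
  rw [mem_fib, mem_fib, Function.comp_apply, hw.inv]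

theorem fib_subset_fib_half (blk : Fin n → ℕ) (k : ℕ) : fib blk k ⊆ fib (half blk) (k / 2) :=
  fun _ ha => mem_fib.2 (congrArg (· / 2) (mem_fib.1 ha))

theorem fib_half_sdiff (blk : Fin n → ℕ) (k : ℕ) :
    fib (half blk) k \ fib blk (2 * k) = fib blk (2 * k + 1) := by
  ext a
  simp only [Finset.mem_sdiff, mem_fib, half]
  omega

theorem content_fib_half (g : Fin n → ℕ) (blk : Fin n → ℕ) (k : ℕ) :
    content g (fib (half blk) k) = content g (fib blk (2 * k)) + content g (fib blk (2 * k + 1)) := by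
  have h : fib blk (2 * k) ⊆ fib (half blk) k := by
    have := fib_subset_fib_half blk (2 * k)
    rwa [Nat.mul_div_cancel_left k two_pos] at this
  rw [content_eq_add_sdiff g h, fib_half_sdiff]

/-- The words `f ∘ v` with prescribed contents `R`, `S`, `Tt` on the block `0`, on the union of the
blocks `1` and `2`, and on the block `3`. -/
def GarnirWord (f blk : Fin n → ℕ) (R S Tt : Multiset ℕ) (v : Equiv.Perm (Fin n)) : Prop :=
  content (f ∘ v) (fib blk 0) = R ∧
    content (f ∘ v) (fib blk 1) + content (f ∘ v) (fib blk 2) = S ∧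
      content (f ∘ v) (fib blk 3) = Tt

/-- The words `f ∘ v` with prescribed contents `A`, `B` on the blocks `0` and `1`. -/
def RowWord (f blk : Fin n → ℕ) (A B : Multiset ℕ) (v : Equiv.Perm (Fin n)) : Prop :=
  content (f ∘ v) (fib blk 0) = A ∧ content (f ∘ v) (fib blk 1) = B

theorem rowWord_mul_iff {f blk : Fin n → ℕ} {A B : Multiset ℕ} {v w : Equiv.Perm (Fin n)}
    (hw : Par blk w) : RowWord f blk A B (v * w) ↔ RowWord f blk A B v := by
  have h : f ∘ ⇑(v * w) = (f ∘ v) ∘ w := rfl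
  rw [RowWord, RowWord, h, content_comp_par _ hw, content_comp_par _ hw]

theorem garnirWord_mul_of_par {f blk : Fin n → ℕ} {R S Tt : Multiset ℕ} {v w : Equiv.Perm (Fin n)}
    (hw : Par blk w) (hv : GarnirWord f blk R S Tt v) : GarnirWord f blk R S Tt (v * w) := by
  have h : f ∘ ⇑(v * w) = (f ∘ v) ∘ w := rfl
  rwa [GarnirWord, h, content_comp_par _ hw, content_comp_par _ hw, content_comp_par _ hw,
    content_comp_par _ hw]

theorem GarnirWord.exists_rowWord {f blk : Fin n → ℕ} {R S Tt : Multiset ℕ}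
    {v : Equiv.Perm (Fin n)} (hv : GarnirWord f blk R S Tt v) :
    ∃ U ≤ S, U.card = (fib blk 1).card ∧ RowWord f (half blk) (R + U) (Tt + (S - U)) v := by
  obtain ⟨rfl, rfl, rfl⟩ := hv
  refine ⟨_, Multiset.le_add_right _ _, card_content _ _, content_fib_half _ _ 0, ?_⟩
  rw [add_tsub_cancel_left, add_comm]
  exact content_fib_half _ _ 1

theorem inc_mul_iff {blk : Fin n → ℕ} {v w : Equiv.Perm (Fin n)} (hv : Inc (half blk) v)
    (hw : Par (half blk) w) : Inc blk (v * w) ↔ Inc blk w := by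
  have key : ∀ a b, blk a = blk b → (v (w a) < v (w b) ↔ w a < w b) := by
    intro a b hab
    have h1 : half blk (w a) = half blk (w b) := by
      rw [hw, hw]
      exact congrArg (· / 2) hab
    refine ⟨fun h => ?_, fun h => hv _ _ h h1⟩
    by_contra hc
    rcases (not_lt.1 hc).lt_or_eq with h2 | h2
    · exact absurd h (hv _ _ h2 h1.symm).not_gt
    · rw [h2] at h
      exact lt_irrefl _ h
  exact ⟨fun h a b hab he => (key a b he).1 (h a b hab he),
    fun h a b hab he => (key a b he).2 (h a b hab he)⟩

theorem permLength_eq_invCount_add {blk : Fin n → ℕ} (hb : Monotone blk) (hb4 : ∀ a, blk a < 4)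
    {w : Equiv.Perm (Fin n)} (hw : Par (half blk) w) (hi : Inc blk w) :
    permLength w = invCount (fib (blk ∘ ⇑w⁻¹) 0) (fib (half blk) 0 \ fib (blk ∘ ⇑w⁻¹) 0)
      + invCount (fib (blk ∘ ⇑w⁻¹) 2) (fib (half blk) 1 \ fib (blk ∘ ⇑w⁻¹) 2) := by
  have hhalf : ∀ x, blk (w⁻¹ x) / 2 = blk x / 2 := fun x => hw.inv x
  have hlt : ∀ x y, blk (w⁻¹ x) < blk (w⁻¹ y) → w⁻¹ x < w⁻¹ y := fun x y h => by
    by_contra hc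
    exact absurd (hb (not_lt.1 hc)) h.not_ge
  have hsame : ∀ x y, w⁻¹ x < w⁻¹ y → blk (w⁻¹ x) = blk (w⁻¹ y) → x < y := fun x y h he => by
    have := hi _ _ h he
    rwa [perm_apply_inv, perm_apply_inv] at this
  rw [← permLength_inv, permLength, invCount, invCount, ← Finset.card_union_of_disjoint]
  · refine Finset.card_bij (fun p _ => (p.2, p.1)) ?_ ?_ ?_
    · rintro ⟨y, x⟩ hp
      simp only [Finset.mem_filter, Finset.mem_univ, true_and] at hp
      have h1 := hb hp.2.le
      have h2 : blk (w⁻¹ x) ≠ blk (w⁻¹ y) := fun h => (hsame x y hp.2 h).not_gt hp.1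
      have h3 := hb hp.1.le
      have h4 := hhalf x
      have h5 := hhalf y
      have h6 := hb4 (w⁻¹ x)
      have h7 := hb4 (w⁻¹ y)
      simp only [Finset.mem_union, Finset.mem_filter, Finset.mem_product, Finset.mem_sdiff, mem_fib,
        Function.comp_apply, half, hp.1, and_true]
      omega
    · rintro ⟨y, x⟩ _ ⟨y', x'⟩ _ h
      simp only [Prod.mk.injEq] at h ⊢
      exact h.symm
    · rintro ⟨x, y⟩ hp
      refine ⟨(y, x), ?_, rfl⟩
      simp only [Finset.mem_union, Finset.mem_filter, Finset.mem_product, Finset.mem_sdiff, mem_fib,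
        Function.comp_apply, half] at hp
      have h5 := hhalf y
      simp only [Finset.mem_filter, Finset.mem_univ, true_and]
      refine ⟨by tauto, hlt x y ?_⟩
      omega
  · rw [Finset.disjoint_left]
    rintro ⟨x, y⟩ h1 h2
    simp only [Finset.mem_filter, Finset.mem_product, mem_fib] at h1 h2
    have := h1.1.1.symm.trans h2.1.1
    omega

/-- Every choice of subsets of the two coarse blocks of the right cardinalities is realized by a
permutation preserving the coarse blocks and increasing on the fine ones. -/
theorem exists_par_half_inc {blk : Fin n → ℕ} (hb : Monotone blk) (hb4 : ∀ a, blk a < 4)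
    {I J : Finset (Fin n)} (hI : I ⊆ fib (half blk) 0) (hJ : J ⊆ fib (half blk) 1)
    (hIc : I.card = (fib blk 0).card) (hJc : J.card = (fib blk 2).card) :
    ∃ w, Par (half blk) w ∧ Inc blk w ∧ fib (blk ∘ ⇑w⁻¹) 0 = I ∧ fib (blk ∘ ⇑w⁻¹) 2 = J := by
  set k : Fin n → ℕ := fun x =>
    if half blk x = 0 then (if x ∈ I then 0 else 1) else (if x ∈ J then 2 else 3) with hk
  have hI' : ∀ x ∈ I, blk x / 2 = 0 := fun x hx => mem_fib.1 (hI hx)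
  have hJ' : ∀ x ∈ J, blk x / 2 = 1 := fun x hx => mem_fib.1 (hJ hx)
  have hkv : ∀ x, blk x / 2 = 0 ∧ x ∈ I ∧ k x = 0 ∨ blk x / 2 = 0 ∧ x ∉ I ∧ k x = 1 ∨
      blk x / 2 = 1 ∧ x ∈ J ∧ k x = 2 ∨ blk x / 2 = 1 ∧ x ∉ J ∧ k x = 3 := fun x => by
    have := hb4 x
    by_cases h : blk x / 2 = 0
    · by_cases hx : x ∈ I
      · exact Or.inl ⟨h, hx, by rw [hk]; exact (if_pos h).trans (if_pos hx)⟩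
      · exact Or.inr (Or.inl ⟨h, hx, by rw [hk]; exact (if_pos h).trans (if_neg hx)⟩)
    · have h1 : blk x / 2 = 1 := by omega
      by_cases hx : x ∈ J
      · exact Or.inr (Or.inr (Or.inl ⟨h1, hx, by rw [hk]; exact (if_neg h).trans (if_pos hx)⟩))
      · exact Or.inr (Or.inr (Or.inr ⟨h1, hx, by rw [hk]; exact (if_neg h).trans (if_neg hx)⟩))
  clear_value k
  have hk4 : ∀ x, k x < 4 := fun x => by
    have := hkv x
    omega
  have hk0 : fib k 0 = I := by
    ext x
    have h1 := hI' x
    have h2 := hkv x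
    rw [mem_fib]
    grind
  have hk2 : fib k 2 = J := by
    ext x
    have h1 := hJ' x
    have h2 := hkv x
    rw [mem_fib]
    grind
  have hkhalf : half k = half blk := by
    funext x
    have h1 := hkv x
    change k x / 2 = blk x / 2
    omega
  have hodd : ∀ c, (fib k (2 * c)).card = (fib blk (2 * c)).card →
      (fib k (2 * c + 1)).card = (fib blk (2 * c + 1)).card := by
    intro c hc
    have h1 := congrArg Multiset.card (content_fib_half k k c)
    have h2 := congrArg Multiset.card (content_fib_half k blk c)
    simp only [Multiset.card_add, card_content, hkhalf] at h1 h2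
    omega
  have hcard : ∀ c, (fib k c).card = (fib blk c).card := by
    intro c
    by_cases hc : c < 4
    · have h0 : (fib k 0).card = (fib blk 0).card := by rw [hk0, hIc]
      have h2 : (fib k 2).card = (fib blk 2).card := by rw [hk2, hJc]
      interval_cases c
      · exact h0
      · exact hodd 0 h0
      · exact h2
      · exact hodd 1 h2
    · have h1 : fib k c = ∅ := Finset.filter_false_of_mem fun x _ => by
        have := hk4 x
        omega
      have h2 : fib blk c = ∅ := Finset.filter_false_of_mem fun x _ => by
        have := hb4 x
        omega
      rw [h1, h2]
  obtain ⟨σ, hσ⟩ := exists_perm_of_card_fiber_eq k blk hcard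
  obtain ⟨v, u, hv, hu, huv⟩ := exists_inc_mul_par hb σ⁻¹
  have hvk : blk ∘ ⇑v⁻¹ = k := by
    funext x
    rw [← hσ x, ← inv_inv σ, huv, mul_inv_rev, Equiv.Perm.mul_apply, hu.inv, Function.comp_apply]
  refine ⟨v, ?_, hv, by rw [hvk, hk0], by rw [hvk, hk2]⟩
  have : Par (half blk) v⁻¹ := fun x => by
    have h1 := congrFun hvk x
    have h2 := congrFun hkhalf x
    simp only [Function.comp_apply] at h1
    simp only [half] at h2 ⊢
    rw [h1, h2]
  simpa using this.inv

theorem eq_of_fib_comp_inv_eq {blk : Fin n → ℕ} (hb : Monotone blk) (hb4 : ∀ a, blk a < 4)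
    {w w' : Equiv.Perm (Fin n)} (hw : Par (half blk) w) (hi : Inc blk w) (hw' : Par (half blk) w')
    (hi' : Inc blk w') (h0 : fib (blk ∘ ⇑w⁻¹) 0 = fib (blk ∘ ⇑w'⁻¹) 0)
    (h2 : fib (blk ∘ ⇑w⁻¹) 2 = fib (blk ∘ ⇑w'⁻¹) 2) : w = w' := by
  have hblk : ∀ x, blk (w⁻¹ x) = blk (w'⁻¹ x) := by
    intro x
    have e0 := Finset.ext_iff.1 h0 x
    have e2 := Finset.ext_iff.1 h2 x
    simp only [mem_fib, Function.comp_apply] at e0 e2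
    have e : blk (w⁻¹ x) / 2 = blk (w'⁻¹ x) / 2 := (hw.inv x).trans (hw'.inv x).symm
    have := hb4 (w⁻¹ x)
    have := hb4 (w'⁻¹ x)
    omega
  have hp : Par blk (w⁻¹ * w') := fun a => by
    rw [Equiv.Perm.mul_apply, hblk, perm_inv_apply]
  have := hi.eq_of_mul hb hp (by rwa [mul_inv_cancel_left])
  rw [inv_mul_eq_one] at this
  exact this

theorem garnirWord_mul_iff {f blk : Fin n → ℕ} {R U V Tt : Multiset ℕ} {v w : Equiv.Perm (Fin n)}
    (hrow : RowWord f (half blk) (R + U) (V + Tt) v) (hw : Par (half blk) w) :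
    GarnirWord f blk R (U + V) Tt (v * w) ↔ content (f ∘ v) (fib (blk ∘ ⇑w⁻¹) 0) = R ∧
      content (f ∘ v) (fib (blk ∘ ⇑w⁻¹) 2) = V := by
  have hrow' := (rowWord_mul_iff hw).2 hrow
  have h0 := content_fib_half (f ∘ ⇑(v * w)) blk 0
  have h1 := content_fib_half (f ∘ ⇑(v * w)) blk 1
  rw [hrow'.1] at h0
  rw [hrow'.2] at h1
  rw [← content_comp_perm, ← content_comp_perm]
  change GarnirWord f blk R (U + V) Tt (v * w) ↔ content (f ∘ ⇑(v * w)) (fib blk 0) = R ∧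
    content (f ∘ ⇑(v * w)) (fib blk 2) = V
  simp only [mul_zero, zero_add, mul_one] at h0 h1
  constructor
  · rintro ⟨e0, e1, e2⟩
    refine ⟨e0, ?_⟩
    rw [e0, add_right_inj] at h0
    rw [← h0] at e1
    exact add_left_cancel e1
  · rintro ⟨e0, e2⟩
    rw [e0, add_right_inj] at h0
    rw [e2, add_right_inj] at h1
    exact ⟨e0, by rw [← h0, e2], h1.symm⟩

/-- The number of ways, weighted by `q ^ length`, in which a row-sorted word arises from a
Garnir word. -/
theorem sum_pow_permLength_eq_garnirWeight {F : Type*} [Field F] (q : F) {f blk : Fin n → ℕ}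
    (hf : Monotone f) (hb : Monotone blk) (hb4 : ∀ a, blk a < 4) {R U V Tt : Multiset ℕ}
    (hR : R.card = (fib blk 0).card) (hV : V.card = (fib blk 2).card) {v : Equiv.Perm (Fin n)}
    (hv : Inc (half blk) v) (hrow : RowWord f (half blk) (R + U) (V + Tt) v) :
    ∑ w with Par (half blk) w ∧ GarnirWord f blk R (U + V) Tt (v * w) ∧ Inc blk (v * w),
      q ^ permLength w = garnirWeight q R U * garnirWeight q V Tt := by
  have hmono : ∀ k, ∀ x ∈ fib (half blk) k, ∀ y ∈ fib (half blk) k, x ≤ y →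
      (f ∘ v) x ≤ (f ∘ v) y := by
    intro k x hx y hy hxy
    rcases hxy.lt_or_eq with h | rfl
    · exact hf (hv x y h ((mem_fib.1 hx).trans (mem_fib.1 hy).symm)).le
    · exact le_rfl
  rw [← sum_pow_invCount q (f ∘ v) _ (hmono 0) R U hrow.1,
    ← sum_pow_invCount q (f ∘ v) _ (hmono 1) V Tt hrow.2, Finset.sum_mul_sum,
    ← Finset.sum_product']
  simp only [ite_mul, zero_mul, mul_ite, mul_zero, ← ite_and, ← pow_add]
  rw [← Finset.sum_filter]
  have hmem : ∀ w, w ∈ Finset.univ.filter (fun w => Par (half blk) w ∧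
      GarnirWord f blk R (U + V) Tt (v * w) ∧ Inc blk (v * w)) ↔ Par (half blk) w ∧
      (content (f ∘ v) (fib (blk ∘ ⇑w⁻¹) 0) = R ∧ content (f ∘ v) (fib (blk ∘ ⇑w⁻¹) 2) = V) ∧
        Inc blk w := by
    intro w
    rw [Finset.mem_filter]
    constructor
    · rintro ⟨-, h1, h2, h3⟩
      exact ⟨h1, (garnirWord_mul_iff hrow h1).1 h2, (inc_mul_iff hv h1).1 h3⟩
    · rintro ⟨h1, h2, h3⟩
      exact ⟨Finset.mem_univ _, h1, (garnirWord_mul_iff hrow h1).2 h2, (inc_mul_iff hv h1).2 h3⟩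
  have hsub : ∀ w, Par (half blk) w → ∀ k, fib (blk ∘ ⇑w⁻¹) k ⊆ fib (half blk) (k / 2) := by
    intro w hw k x hx
    rw [mem_fib] at hx ⊢
    rw [← hw.inv x, ← hx]
    rfl
  refine Finset.sum_bij (fun w _ => (fib (blk ∘ ⇑w⁻¹) 0, fib (blk ∘ ⇑w⁻¹) 2)) ?_ ?_ ?_ ?_
  · intro w hw
    obtain ⟨h1, h2, -⟩ := (hmem w).1 hw
    rw [Finset.mem_filter, Finset.mem_product, Finset.mem_powerset, Finset.mem_powerset]
    exact ⟨⟨hsub w h1 0, hsub w h1 2⟩, h2.symm⟩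
  · intro w hw w' hw' he
    obtain ⟨h1, -, h3⟩ := (hmem w).1 hw
    obtain ⟨h1', -, h3'⟩ := (hmem w').1 hw'
    rw [Prod.mk.injEq] at he
    exact eq_of_fib_comp_inv_eq hb hb4 h1 h3 h1' h3' he.1 he.2
  · rintro ⟨I, J⟩ hp
    rw [Finset.mem_filter, Finset.mem_product, Finset.mem_powerset, Finset.mem_powerset] at hp
    obtain ⟨⟨hI, hJ⟩, hJV, hIR⟩ := hp
    obtain ⟨w, h1, h2, h3, h4⟩ := exists_par_half_inc hb hb4 hI hJ
      (by rw [← hR, ← hIR]; exact (Multiset.card_map _ _).symm)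
      (by rw [← hV, ← hJV]; exact (Multiset.card_map _ _).symm)
    refine ⟨w, (hmem w).2 ⟨h1, ⟨?_, ?_⟩, h2⟩, by rw [h3, h4]⟩
    · rw [h3]
      exact hIR
    · rw [h4]
      exact hJV
  · intro w hw
    obtain ⟨h1, -, h3⟩ := (hmem w).1 hw
    rw [permLength_eq_invCount_add hb hb4 h1 h3]

end Words

section GarnirIdentity

variable {F : Type*} [Field F] {q : F} {H : Type*} [Ring H] [Algebra F H] {n : ℕ}
  {T : Equiv.Perm (Fin n) → H}

theorem sum_garnirWord_mul (hT : IsHeckeBasis q T) {f blk : Fin n → ℕ} (hf : Monotone f)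
    (hb : Monotone blk) (hb4 : ∀ a, blk a < 4) {R S Tt : Multiset ℕ}
    (hR : R.card = (fib blk 0).card) (hS : S.card = (fib blk 1).card + (fib blk 2).card) {D : H}
    (hD : parSum T (half blk) = parSum T blk * D) :
    (∑ v with GarnirWord f blk R S Tt v, invBasis T v) * D
      = ∑ U ∈ S.powerset.toFinset with U.card = (fib blk 1).card,
          (garnirWeight q R U * garnirWeight q (S - U) Tt) •
            ∑ v with RowWord f (half blk) (R + U) (Tt + (S - U)) v, invBasis T v := by
  set Y := parSum T (half blk) with hY
  have hrow : ∀ U, ∑ v with RowWord f (half blk) (R + U) (Tt + (S - U)) v, invBasis T v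
      = ∑ v with Inc (half blk) v,
        if RowWord f (half blk) (R + U) (Tt + (S - U)) v then invBasis T v * Y else 0 := by
    intro U
    rw [sum_eq_sum_inc_mul_parSum hT (monotone_half hb) _ fun v u hu hv => (rowWord_mul_iff hu).2 hv,
      Finset.sum_mul, ← Finset.sum_filter, Finset.filter_filter]
    exact Finset.sum_congr (Finset.filter_congr fun v _ => and_comm) fun _ _ => rfl
  have hmul : ∀ v w, Inc (half blk) v → Par (half blk) w →
      invBasis T (v * w) * Y = q ^ permLength w • (invBasis T v * Y) := by
    intro v w hv hw
    rw [← invBasis_mul_of_inc_of_par hT (monotone_half hb) hv hw, mul_assoc,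
      invBasis_mul_parSum hT (monotone_half hb) hw, mul_smul_comm]
  calc (∑ v with GarnirWord f blk R S Tt v, invBasis T v) * D
      = ∑ v, if GarnirWord f blk R S Tt v ∧ Inc blk v then invBasis T v * Y else 0 := by
        rw [sum_eq_sum_inc_mul_parSum hT hb _ fun v u hu hv => garnirWord_mul_of_par hu hv,
          mul_assoc, ← hD, Finset.sum_mul, ← Finset.sum_filter]
    _ = ∑ v with Inc (half blk) v, ∑ w with Par (half blk) w,
          if GarnirWord f blk R S Tt (v * w) ∧ Inc blk (v * w) then invBasis T (v * w) * Y
          else 0 := by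
        simpa only [Finset.filter_true, true_and] using
          sum_eq_sum_inc_par (monotone_half hb) (fun _ => True) (fun _ _ _ _ => trivial)
            fun v => if GarnirWord f blk R S Tt v ∧ Inc blk v then invBasis T v * Y else 0
    _ = ∑ v with Inc (half blk) v, (∑ w with Par (half blk) w ∧ GarnirWord f blk R S Tt (v * w) ∧
          Inc blk (v * w), q ^ permLength w) • (invBasis T v * Y) := by
        refine Finset.sum_congr rfl fun v hv => ?_
        rw [← Finset.sum_filter, Finset.filter_filter, Finset.sum_smul]
        refine Finset.sum_congr rfl fun w hw => ?_
        exact hmul v w (Finset.mem_filter.1 hv).2 (Finset.mem_filter.1 hw).2.1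
    _ = ∑ v with Inc (half blk) v, ∑ U ∈ S.powerset.toFinset with U.card = (fib blk 1).card,
          (garnirWeight q R U * garnirWeight q (S - U) Tt) •
            if RowWord f (half blk) (R + U) (Tt + (S - U)) v then invBasis T v * Y else 0 := by
        refine Finset.sum_congr rfl fun v hv => ?_
        have hv' := (Finset.mem_filter.1 hv).2
        by_cases hex : ∃ U ∈ S.powerset.toFinset.filter (fun U => U.card = (fib blk 1).card),
            RowWord f (half blk) (R + U) (Tt + (S - U)) v
        · obtain ⟨U, hU, hUv⟩ := hex
          rw [Finset.sum_eq_single_of_mem U hU, if_pos hUv]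
          · rw [Finset.mem_filter, Multiset.mem_toFinset, Multiset.mem_powerset] at hU
            have hV : (S - U).card = (fib blk 2).card := by
              rw [Multiset.card_sub hU.1]
              omega
            have hUv' : RowWord f (half blk) (R + U) (S - U + Tt) v := by
              rwa [add_comm (S - U)]
            rw [← sum_pow_permLength_eq_garnirWeight q hf hb hb4 hR hV hv' hUv',
              add_tsub_cancel_of_le hU.1]
          · intro U' _ hne
            rw [if_neg, smul_zero]
            exact fun h => hne (add_left_cancel (h.1.symm.trans hUv.1))
        · have hl : ∑ w with Par (half blk) w ∧ GarnirWord f blk R S Tt (v * w) ∧ Inc blk (v * w),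
              q ^ permLength w = 0 := by
            refine Finset.sum_eq_zero fun w hw => ?_
            obtain ⟨hw1, hw2, -⟩ := (Finset.mem_filter.1 hw).2
            obtain ⟨U, hUS, hUc, hU⟩ := hw2.exists_rowWord
            refine absurd ⟨U, ?_, (rowWord_mul_iff hw1).1 hU⟩ hex
            rw [Finset.mem_filter, Multiset.mem_toFinset, Multiset.mem_powerset]
            exact ⟨hUS, hUc⟩
          rw [hl, zero_smul]
          symm
          refine Finset.sum_eq_zero fun U hU => ?_
          rw [if_neg fun h => hex ⟨U, hU, h⟩, smul_zero]
    _ = _ := by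
        rw [Finset.sum_comm]
        exact Finset.sum_congr rfl fun U _ => by rw [hrow, Finset.smul_sum]

end GarnirIdentity

section Rows

theorem rowOf_le_of_lt {lam : ℕ → ℕ} {p r : ℕ} (h : p < cumSum lam (r + 1)) : rowOf lam p ≤ r :=
  Nat.sInf_le h

theorem rowOf_lt_of_lt {lam : ℕ → ℕ} {p N : ℕ} (h : p < cumSum lam N) : rowOf lam p < N := by
  rcases N with _ | N
  · simp [cumSum] at h
  · exact Nat.lt_succ_of_le (rowOf_le_of_lt h)

theorem lt_cumSum_rowOf {lam : ℕ → ℕ} {p N : ℕ} (h : p < cumSum lam N) :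
    p < cumSum lam (rowOf lam p + 1) := by
  rcases N with _ | N
  · simp [cumSum] at h
  · exact Nat.sInf_mem (s := {r | p < cumSum lam (r + 1)}) ⟨N, h⟩

/-- The row function of `lam` on the positions `0, …, n - 1`. -/
def rowFn (n : ℕ) (lam : ℕ → ℕ) : Fin n → ℕ := fun p => rowOf lam p

theorem monotone_rowFn {n : ℕ} {lam : ℕ → ℕ} {N : ℕ} (h : n ≤ cumSum lam N) :
    Monotone (rowFn n lam) := fun _ b hab =>
  rowOf_le_of_lt (lt_of_le_of_lt hab (lt_cumSum_rowOf (b.2.trans_le h)))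

theorem cumSum_comp2_one (m k : ℕ) : cumSum (comp2 m k) 1 = m := by
  simp [cumSum, comp2]

theorem cumSum_comp2_two (m k : ℕ) : cumSum (comp2 m k) 2 = m + k := by
  simp [cumSum, comp2, Finset.sum_range_succ]

theorem rowOf_comp2 {m k p : ℕ} (hp : p < m + k) :
    rowOf (comp2 m k) p = if p < m then 0 else 1 := by
  rw [← cumSum_comp2_two] at hp
  have h1 := rowOf_lt_of_lt hp
  have h2 := lt_cumSum_rowOf hp
  split_ifs with h
  · rw [← cumSum_comp2_one m k] at h
    have := rowOf_lt_of_lt h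
    omega
  · by_contra hc
    rw [show rowOf (comp2 m k) p = 0 by omega, zero_add, cumSum_comp2_one] at h2
    exact h h2

theorem le_cumSum_count (A : Multiset ℕ) {lam : ℕ → ℕ} (hlam : ∀ v, lam v = A.count v) :
    ∃ N, A.card ≤ cumSum lam N := by
  refine ⟨A.toFinset.sup id + 1, ?_⟩
  rw [← Multiset.toFinset_sum_count_eq, cumSum, Finset.sum_congr rfl fun v _ => hlam v]
  refine Finset.sum_le_sum_of_subset fun v hv => ?_
  rw [Finset.mem_range, Nat.lt_succ_iff]
  exact Finset.le_sup (f := id) hv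

theorem one_le_conjP_comp2 {m k i : ℕ} (hi : i < m) : 1 ≤ conjP (comp2 m k) i := by
  have h : conjP (comp2 m k) i ∈ {r | comp2 m k r ≤ i} :=
    Nat.sInf_mem ⟨2, by simp [comp2]⟩
  by_contra hc
  rw [show conjP (comp2 m k) i = 0 by omega] at h
  simp [comp2] at h
  omega

theorem two_le_conjP_comp2 {m k i : ℕ} (hi : i < m) (hk : i < k) :
    2 ≤ conjP (comp2 m k) i := by
  have h : conjP (comp2 m k) i ∈ {r | comp2 m k r ≤ i} :=
    Nat.sInf_mem ⟨2, by simp [comp2]⟩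
  have h1 := one_le_conjP_comp2 (k := k) hi
  by_contra hc
  rw [show conjP (comp2 m k) i = 1 by omega] at h
  simp [comp2] at h
  omega

theorem le_cumSum_conjP_comp2 {m k : ℕ} (hkm : k ≤ m) : m + k ≤ cumSum (conjP (comp2 m k)) m := by
  have h : ∀ i ∈ Finset.range m, 1 + (if i < k then 1 else 0) ≤ conjP (comp2 m k) i := by
    intro i hi
    rw [Finset.mem_range] at hi
    split_ifs with hk
    · exact two_le_conjP_comp2 hi hk
    · exact one_le_conjP_comp2 hi
  refine le_trans (le_of_eq ?_) (Finset.sum_le_sum h)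
  rw [Finset.sum_add_distrib, Finset.sum_const, Finset.card_range, smul_eq_mul, mul_one,
    ← Finset.sum_filter, Finset.sum_const, smul_eq_mul, mul_one]
  congr 1
  rw [show (Finset.range m).filter (· < k) = Finset.range k by ext; simp; omega, Finset.card_range]

variable {n : ℕ}

theorem map_val_filter_Ico {lo hi : ℕ} (h : hi ≤ n) :
    (Finset.univ.filter fun a : Fin n => lo ≤ (a : ℕ) ∧ (a : ℕ) < hi).map Fin.valEmbedding
      = Finset.Ico lo hi := by
  ext x
  simp only [Finset.mem_map, Finset.mem_filter, Finset.mem_univ, true_and, Fin.valEmbedding_apply,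
    Finset.mem_Ico]
  exact ⟨fun ⟨a, ha, hax⟩ => hax ▸ ha, fun hx => ⟨⟨x, hx.2.trans_le h⟩, hx, rfl⟩⟩

theorem card_filter_Ico {lo hi : ℕ} (h : hi ≤ n) :
    (Finset.univ.filter fun a : Fin n => lo ≤ (a : ℕ) ∧ (a : ℕ) < hi).card = hi - lo := by
  rw [← Finset.card_map Fin.valEmbedding, map_val_filter_Ico h, Nat.card_Ico]

theorem content_getD_sort (A : Multiset ℕ) {lo hi : ℕ} (h : hi ≤ n) (hA : lo + A.card = hi) :
    content (fun a : Fin n => (A.sort (· ≤ ·)).getD ((a : ℕ) - lo) 0)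
      (Finset.univ.filter fun a : Fin n => lo ≤ (a : ℕ) ∧ (a : ℕ) < hi) = A := by
  have h1 : ∀ s : Finset (Fin n), content (fun a : Fin n => (A.sort (· ≤ ·)).getD ((a : ℕ) - lo) 0) s
      = (s.map Fin.valEmbedding).val.map fun x => (A.sort (· ≤ ·)).getD (x - lo) 0 := fun s => by
    rw [Finset.map_val, Multiset.map_map]
    rfl
  have h2 : Finset.Ico lo hi = (Finset.range A.card).map (addLeftEmbedding lo) := by
    rw [Finset.range_eq_Ico, Finset.map_add_left_Ico, add_zero, hA]
  rw [h1, map_val_filter_Ico h, h2, Finset.map_val, Multiset.map_map]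
  have h3 : ((List.range A.card).map fun x => (A.sort (· ≤ ·)).getD x 0) = A.sort (· ≤ ·) := by
    refine List.ext_getElem (by simp) fun i hi hi' => ?_
    simp [List.getElem?_eq_getElem hi']
  conv_rhs => rw [← Multiset.sort_eq A (· ≤ ·), ← h3]
  rw [Finset.range_val, Multiset.range, Multiset.map_coe]
  congr 1
  refine List.map_congr_left fun x _ => ?_
  simp

theorem card_filter_pair (C g : Fin n → ℕ) (k c : ℕ) :
    (Finset.univ.filter fun x => (C x, g x) = (k, c)).card = (content g (fib C k)).count c := by
  rw [content, Multiset.count_map, Finset.card_def]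
  congr 1
  rw [fib, Finset.filter_val, Finset.filter_val, Multiset.filter_filter]
  refine Multiset.filter_congr fun x _ => ?_
  rw [Prod.mk.injEq, and_comm, eq_comm (a := c)]

theorem mem_doubleCoset_iff (lam mu : ℕ → ℕ) (d w : Equiv.Perm (Fin n)) :
    w ∈ doubleCoset lam mu d ↔ ∀ k, content (rowFn n lam ∘ ⇑w⁻¹) (fib (rowFn n mu) k)
      = content (rowFn n lam ∘ ⇑d⁻¹) (fib (rowFn n mu) k) := by
  constructor
  · rintro ⟨u, hu, v, hv, rfl⟩ k
    have hu' : Par (rowFn n lam) u := hu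
    have hv' : Par (rowFn n mu) v := hv
    have h : rowFn n lam ∘ ⇑(v * d * u)⁻¹ = (rowFn n lam ∘ ⇑d⁻¹) ∘ ⇑v⁻¹ := by
      funext x
      rw [mul_inv_rev, mul_inv_rev]
      exact hu'.inv _
    rw [h, content_comp_par _ hv'.inv]
  · intro h
    obtain ⟨σ, hσ⟩ := exists_perm_of_card_fiber_eq
      (fun x => (rowFn n mu x, (rowFn n lam ∘ ⇑w⁻¹) x))
      (fun x => (rowFn n mu x, (rowFn n lam ∘ ⇑d⁻¹) x)) fun ⟨k, c⟩ => by
        rw [card_filter_pair, card_filter_pair, h k]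
    simp only [Prod.mk.injEq, Function.comp_apply] at hσ
    have hσp : Par (rowFn n mu) σ := fun x => (hσ x).1
    refine ⟨d⁻¹ * σ * w, fun p => ?_, σ⁻¹, hσp.inv, by group⟩
    have := (hσ (w p)).2
    rw [perm_inv_apply] at this
    exact this

theorem rowWord_inv_of_is1A {m k : ℕ} (hmk : m + k = n) {lam : ℕ → ℕ} {A B : Multiset ℕ}
    (hA : A.card = m) (hB : B.card = k) {d : Equiv.Perm (Fin n)}
    (hd : Is1A (comp2 m k) lam (rows2 A B) d) :
    RowWord (rowFn n lam) (rowFn n (comp2 m k)) A B d⁻¹ := by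
  have hrow : ∀ a : Fin n, rowFn n (comp2 m k) a = if (a : ℕ) < m then 0 else 1 := fun a =>
    rowOf_comp2 (a.2.trans_eq hmk.symm)
  have hval : ∀ x : Fin n, (rowFn n lam ∘ ⇑d⁻¹) x = entryAt (rows2 A B) (rowFn n (comp2 m k) x)
      ((x : ℕ) - cumSum (comp2 m k) (rowFn n (comp2 m k) x)) := fun x => by
    have := hd.2 (d⁻¹ x)
    rw [perm_apply_inv] at this
    exact this.symm
  have hcongr : ∀ (g g' : Fin n → ℕ) (s s' : Finset (Fin n)), s = s' → (∀ x ∈ s', g x = g' x) →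
      content g s = content g' s' := fun g g' s s' hs hg => by
    rw [hs]
    exact Multiset.map_congr rfl hg
  constructor
  · refine (hcongr _ _ _ _ ?_ fun x hx => ?_).trans
      (content_getD_sort A (n := n) (lo := 0) (hi := m) (by omega) (by omega))
    · ext a
      rw [mem_fib, hrow]
      simp
    · rw [hval, hrow, if_pos (Finset.mem_filter.1 hx).2.2]
      rfl
  · refine (hcongr _ _ _ _ ?_ fun x hx => ?_).trans
      (content_getD_sort B (n := n) (lo := m) (hi := n) le_rfl (by omega))
    · ext a
      rw [mem_fib, hrow]
      simp
    · rw [hval, hrow, if_neg (Finset.mem_filter.1 hx).2.1.not_gt, cumSum_comp2_one]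
      rfl

theorem xPhi_eq_sum_rowWord {H : Type*} [Ring H] (T : Equiv.Perm (Fin n) → H) {m k : ℕ}
    (hmk : m + k = n) {lam : ℕ → ℕ} {A B : Multiset ℕ} (hA : A.card = m) (hB : B.card = k)
    {d : Equiv.Perm (Fin n)} (hd : Is1A (comp2 m k) lam (rows2 A B) d) :
    XPhi T lam (comp2 m k) d
      = ∑ v with RowWord (rowFn n lam) (rowFn n (comp2 m k)) A B v, invBasis T v := by
  have hd' := rowWord_inv_of_is1A hmk hA hB hd
  have hmem : ∀ w, w ∈ doubleCoset lam (comp2 m k) d ↔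
      RowWord (rowFn n lam) (rowFn n (comp2 m k)) A B w⁻¹ := by
    intro w
    rw [mem_doubleCoset_iff]
    constructor
    · intro h
      exact ⟨(h 0).trans hd'.1, (h 1).trans hd'.2⟩
    · intro h c
      rcases c with _ | _ | c
      · exact h.1.trans hd'.1.symm
      · exact h.2.trans hd'.2.symm
      · have : fib (rowFn n (comp2 m k)) (c + 1 + 1) = ∅ := Finset.filter_false_of_mem fun x _ => by
          rw [rowFn, rowOf_comp2 (x.2.trans_eq hmk.symm)]
          split_ifs <;> simp
        rw [this]
        rfl
  rw [XPhi]
  refine Finset.sum_bij' (fun w _ => w⁻¹) (fun w _ => w⁻¹) ?_ ?_ ?_ ?_ ?_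
  · intro w hw
    exact Finset.mem_filter.2 ⟨Finset.mem_univ _, (hmem w).1 (Finset.mem_filter.1 hw).2⟩
  · intro w hw
    refine Finset.mem_filter.2 ⟨Finset.mem_univ _, (hmem _).2 ?_⟩
    rw [inv_inv]
    exact (Finset.mem_filter.1 hw).2
  · intro w _
    exact inv_inv w
  · intro w _
    exact inv_inv w
  · intro w _
    rw [invBasis, inv_inv]

variable {F : Type*} [Field F] {H : Type*} [Ring H] [Algebra F H]

theorem yElt_eq_signedParSum (q : F) (T : Equiv.Perm (Fin n) → H) (mu : ℕ → ℕ) :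
    yElt q T mu = signedParSum q T (rowFn n mu) := by
  refine (sum_inv_of_inv_mem (Par (rowFn n mu)) (fun _ hv => hv.inv) _).trans ?_
  refine Finset.sum_congr rfl fun v _ => ?_
  rw [permLength_inv]
  rfl

end Rows

section GarnirRelation

variable {n : ℕ}

theorem garnirWord_iff_half_succ {f blk : Fin n → ℕ} (hb4 : ∀ a, blk a < 4) {R S Tt : Multiset ℕ}
    (v : Equiv.Perm (Fin n)) : GarnirWord f blk R S Tt v ↔
      content (f ∘ v) (fib (half fun a => blk a + 1) 0) = R ∧
      content (f ∘ v) (fib (half fun a => blk a + 1) 1) = S ∧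
      content (f ∘ v) (fib (half fun a => blk a + 1) 2) = Tt := by
  have h0 : fib (half fun a => blk a + 1) 0 = fib blk 0 := by
    ext a
    simp only [mem_fib, half]
    omega
  have h3 : fib (half fun a => blk a + 1) 2 = fib blk 3 := by
    ext a
    have := hb4 a
    simp only [mem_fib, half]
    omega
  have h12 : ∀ k, fib (fun a => blk a + 1) (k + 1) = fib blk k := fun k => by
    ext a
    simp only [mem_fib, add_left_inj]
  rw [h0, h3, content_fib_half, h12, h12]
  rfl

theorem garnirWord_mul_of_par_half_succ {f blk : Fin n → ℕ} (hb4 : ∀ a, blk a < 4)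
    {R S Tt : Multiset ℕ} {v w : Equiv.Perm (Fin n)} (hw : Par (half fun a => blk a + 1) w)
    (hv : GarnirWord f blk R S Tt v) : GarnirWord f blk R S Tt (v * w) := by
  have h : f ∘ ⇑(v * w) = (f ∘ v) ∘ w := rfl
  rw [garnirWord_iff_half_succ hb4] at hv ⊢
  rwa [h, content_comp_par _ hw, content_comp_par _ hw, content_comp_par _ hw]

/-- The block function with cut points `a ≤ b ≤ c`. -/
def cut3 (n a b c : ℕ) : Fin n → ℕ := fun x =>
  if (x : ℕ) < a then 0 else if (x : ℕ) < b then 1 else if (x : ℕ) < c then 2 else 3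

theorem cut3_lt_four (a b c : ℕ) (x : Fin n) : cut3 n a b c x < 4 := by
  unfold cut3
  split_ifs <;> omega

theorem monotone_cut3 (a b c : ℕ) : Monotone (cut3 n a b c) := fun x y h => by
  have : (x : ℕ) ≤ y := h
  unfold cut3
  split_ifs <;> omega

theorem card_fib_cut3_zero {a b c : ℕ} (ha : a ≤ n) : (fib (cut3 n a b c) 0).card = a := by
  refine (congrArg Finset.card ?_).trans (card_filter_Ico (lo := 0) ha)
  ext x
  simp only [mem_fib, cut3, Finset.mem_filter, Finset.mem_univ, true_and]
  grind

theorem card_fib_cut3_one {a b c : ℕ} (hb : b ≤ n) : (fib (cut3 n a b c) 1).card = b - a := by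
  rw [← card_filter_Ico (lo := a) hb]
  congr 1
  ext x
  simp only [mem_fib, cut3, Finset.mem_filter, Finset.mem_univ, true_and]
  grind

theorem card_fib_cut3_two {a b c : ℕ} (hab : a ≤ b) (hc : c ≤ n) :
    (fib (cut3 n a b c) 2).card = c - b := by
  rw [← card_filter_Ico (lo := b) hc]
  congr 1
  ext x
  simp only [mem_fib, cut3, Finset.mem_filter, Finset.mem_univ, true_and]
  grind

variable {F : Type*} [Field F] {q : F} {H : Type*} [Ring H] [Algebra F H]
  {T : Equiv.Perm (Fin n) → H}

/-- The two-row Garnir relation. -/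
theorem garnir_relation (hT : IsHeckeBasis q T) (hq : q ≠ 0) {m k : ℕ} (hmk : m + k = n)
    (hkm : k ≤ m) {R S Tt : Multiset ℕ} {lam : ℕ → ℕ} (hlam : ∀ v, lam v = (R + S + Tt).count v)
    (hn : R.card + S.card + Tt.card = n) (hRm : R.card ≤ m) (hSm : m < S.card)
    {d : Multiset ℕ → Equiv.Perm (Fin n)}
    (hd : ∀ U ∈ S.powerset.toFinset.filter (fun U => U.card + R.card = m),
      Is1A (comp2 m k) lam (rows2 (R + U) (Tt + (S - U))) (d U)) (x : H) :
    ∑ U ∈ S.powerset.toFinset.filter (fun U => U.card + R.card = m),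
      (garnirWeight q R U * garnirWeight q (S - U) Tt) •
        (XPhi T lam (comp2 m k) (d U) * (x * yElt q T (conjP (comp2 m k)))) = 0 := by
  set blk := cut3 n R.card m (R.card + S.card) with hblk
  have hb : Monotone blk := monotone_cut3 _ _ _
  have hb4 : ∀ a, blk a < 4 := cut3_lt_four _ _ _
  have hf : Monotone (rowFn n lam) := by
    obtain ⟨N, hN⟩ := le_cumSum_count _ hlam
    rw [Multiset.card_add, Multiset.card_add, hn] at hN
    exact monotone_rowFn hN
  have hhalf : half blk = rowFn n (comp2 m k) := by
    funext a
    rw [rowFn, rowOf_comp2 (a.2.trans_eq hmk.symm), half, hblk, cut3]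
    split_ifs <;> omega
  have hR : R.card = (fib blk 0).card := (card_fib_cut3_zero (by omega)).symm
  have h1 : (fib blk 1).card = m - R.card := card_fib_cut3_one (by omega)
  have h2 : (fib blk 2).card = R.card + S.card - m := card_fib_cut3_two hRm (by omega)
  obtain ⟨D, hD⟩ := exists_parSum_eq_parSum_mul hT (coarse := half blk) hb fun _ hu => hu.half
  have key := sum_garnirWord_mul hT hf hb hb4 (S := S) (Tt := Tt) hR (by omega) hD
  have hcum := hmk.symm.trans_le (le_cumSum_conjP_comp2 hkm)
  have hlt : ∀ a, rowFn n (conjP (comp2 m k)) a < m := fun a =>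
    rowOf_lt_of_lt (a.2.trans_le hcum)
  have hzero := mul_mul_signedParSum_eq_zero hT hq (monotone_rowFn hcum) hlt hSm (r := R.card) (by omega)
    (∑ v with GarnirWord (rowFn n lam) blk R S Tt v, invBasis T v) (fun i h hi1 hi2 =>
      exists_sum_eq_mul_one_add hT _ i h fun v hv =>
        garnirWord_mul_of_par_half_succ hb4 (par_adjT i h (by
          simp only [half, hblk, cut3]
          split_ifs <;> omega)) hv) (D * x)
  rw [← mul_assoc, key, mul_assoc, ← yElt_eq_signedParSum, Finset.sum_mul] at hzero
  rw [← hzero]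
  have hfilter : S.powerset.toFinset.filter (fun U => U.card + R.card = m)
      = S.powerset.toFinset.filter (fun U => U.card = (fib blk 1).card) :=
    Finset.filter_congr fun U _ => by omega
  rw [← hfilter]
  refine Finset.sum_congr rfl fun U hU => ?_
  have hdU := hd U hU
  rw [Finset.mem_filter, Multiset.mem_toFinset, Multiset.mem_powerset] at hU
  have hle := Multiset.card_le_card hU.1
  rw [xPhi_eq_sum_rowWord T hmk (by rw [Multiset.card_add]; omega)
    (by rw [Multiset.card_add, Multiset.card_sub hU.1]; omega) hdU, hhalf, smul_mul_assoc]

end GarnirRelation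

section Tableaux

theorem le_card_filter_le_getD_sort (A : Multiset ℕ) {i : ℕ} (hi : i < A.card) :
    A.card - i ≤ (A.filter fun k => (A.sort (· ≤ ·)).getD i 0 ≤ k).card := by
  set L := A.sort (· ≤ ·) with hL
  have hlen : L.length = A.card := Multiset.length_sort _
  have hpw : L.Pairwise (· ≤ ·) := Multiset.pairwise_sort _ _
  have hcoe : A.filter (fun k => L.getD i 0 ≤ k) = (L.filter fun k => L.getD i 0 ≤ k : List ℕ) := by
    rw [← Multiset.filter_coe, hL, Multiset.sort_eq]
  rw [hcoe, Multiset.coe_card, ← hlen, ← List.length_drop,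
    ← List.filter_eq_self (l := L.drop i) (p := fun k => decide (L.getD i 0 ≤ k)) |>.2]
  · exact ((List.drop_sublist i L).filter _).length_le
  · intro x hx
    obtain ⟨k, hk, rfl⟩ := List.mem_iff_getElem.1 hx
    rw [decide_eq_true_eq, List.getElem_drop, List.getD_eq_getElem _ _ (by omega)]
    rcases Nat.eq_zero_or_pos k with rfl | hk'
    · exact le_rfl
    · exact List.pairwise_iff_getElem.1 hpw _ _ _ _ (by omega)

theorem succ_le_card_filter_le_getD_sort (A : Multiset ℕ) {i : ℕ} (hi : i < A.card) :
    i + 1 ≤ (A.filter fun k => k ≤ (A.sort (· ≤ ·)).getD i 0).card := by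
  set L := A.sort (· ≤ ·) with hL
  have hlen : L.length = A.card := Multiset.length_sort _
  have hpw : L.Pairwise (· ≤ ·) := Multiset.pairwise_sort _ _
  have hcoe : A.filter (fun k => k ≤ L.getD i 0) = (L.filter fun k => k ≤ L.getD i 0 : List ℕ) := by
    rw [← Multiset.filter_coe, hL, Multiset.sort_eq]
  have htake : (L.take (i + 1)).length = i + 1 := by
    rw [List.length_take]
    omega
  rw [hcoe, Multiset.coe_card, ← htake,
    ← List.filter_eq_self (l := L.take (i + 1)) (p := fun k => decide (k ≤ L.getD i 0)) |>.2]
  · exact ((List.take_sublist (i + 1) L).filter _).length_le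
  · intro x hx
    obtain ⟨k, hk, rfl⟩ := List.mem_iff_getElem.1 hx
    rw [htake] at hk
    rw [decide_eq_true_eq, List.getElem_take, List.getD_eq_getElem _ _ (by omega)]
    rcases (Nat.lt_succ_iff.1 hk).lt_or_eq with h | rfl
    · exact List.pairwise_iff_getElem.1 hpw _ _ _ _ h
    · exact le_rfl

theorem qBinomProd_eq_one_of_disjoint {F : Type*} [Field F] (q : F) {A B : Multiset ℕ}
    (h : ∀ x ∈ A, x ∉ B) : qBinomProd q A B = 1 := by
  refine Finset.prod_eq_one fun x _ => ?_
  rw [Multiset.count_add]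
  by_cases hx : x ∈ A
  · rw [Multiset.count_eq_zero.2 (h x hx), add_zero, qBinom_self]
  · rw [Multiset.count_eq_zero.2 hx, qBinom_zero_right]

theorem invPairs_eq_zero {A B : Multiset ℕ} (h : ∀ x ∈ A, ∀ y ∈ B, x ≤ y) : invPairs A B = 0 := by
  rw [invPairs, Multiset.card_eq_zero, Multiset.filter_eq_nil]
  rintro ⟨x, y⟩ hxy
  have := Multiset.mem_product.1 hxy
  exact (h x this.1 y this.2).not_gt

theorem sum_lt_sum_of_card_eq {U W : Multiset ℕ} {j : ℕ} (hcard : U.card = W.card) (hne : U ≠ W)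
    (hU : ∀ x ∈ U - W, x ≤ j) (hW : ∀ y ∈ W, j ≤ y) : U.sum < W.sum := by
  have eU := Multiset.sub_add_inter U W
  have eW := Multiset.sub_add_inter W U
  rw [Multiset.inter_comm] at eW
  have cU := congrArg Multiset.card eU
  have cW := congrArg Multiset.card eW
  have sU := congrArg Multiset.sum eU
  have sW := congrArg Multiset.sum eW
  rw [Multiset.card_add] at cU cW
  rw [Multiset.sum_add] at sU sW
  have hpos : 0 < (U - W).card := by
    rw [Nat.pos_iff_ne_zero, Ne, Multiset.card_eq_zero]
    intro h
    have h' : W - U = 0 := by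
      rw [← Multiset.card_eq_zero]
      rw [h, Multiset.card_zero] at cU
      omega
    rw [h'] at eW
    rw [h] at eU
    exact hne (eU.symm.trans eW)
  have hsub : ∀ y ∈ W - U, j ≤ y := fun y hy =>
    hW y (Multiset.mem_of_le (Multiset.sub_le_self W U) hy)
  have hc : (U - W).card = (W - U).card := by omega
  suffices (U - W).sum < (W - U).sum by omega
  by_cases hj : j ∈ U - W
  · have hjW : j ∉ W - U := by
      rw [Multiset.mem_sub] at hj ⊢
      omega
    have h1 := Multiset.sum_le_card_nsmul _ _ hU
    have h2 := Multiset.card_nsmul_le_sum (s := W - U) (a := j + 1) fun y hy =>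
      Nat.succ_le_of_lt (lt_of_le_of_ne (hsub y hy) fun h => hjW (h ▸ hy))
    rw [smul_eq_mul] at h1 h2
    rw [hc] at h1 hpos
    rw [mul_add, mul_one] at h2
    omega
  · have h2 := Multiset.card_nsmul_le_sum hsub
    have hlt : ∀ x ∈ U - W, x < j := fun x hx =>
      lt_of_le_of_ne (hU x hx) fun h => hj (h ▸ hx)
    obtain ⟨x, hx⟩ := Multiset.card_pos_iff_exists_mem.1 hpos
    obtain ⟨i, rfl⟩ := Nat.exists_eq_succ_of_ne_zero (Nat.ne_zero_of_lt (hlt x hx))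
    have h1 := Multiset.sum_le_card_nsmul _ i fun x hx => Nat.lt_succ_iff.1 (hlt x hx)
    rw [smul_eq_mul] at h1 h2
    rw [hc] at h1 hpos
    rw [Nat.succ_eq_add_one, mul_add, mul_one] at h2
    omega

end Tableaux

/-- the semistandardising step for two-row tableaux.
`μ = (m, n-m) ⊢ n`; `A` (rows `A0, A1`) a row-standard `μ`-tableau which is not
semistandard, witnessed by column `i` with `A(1,i) ≥ A(2,i)`; `j = A(1,i)`;
`R = {k ∈ A^1 : k < j}`, `U₀ = {k ∈ A^1 : k ≥ j}`, `V₀ = {k ∈ A^2 : k ≤ j}`,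
`T = {k ∈ A^2 : k > j}`, `S = U₀ ⊔ V₀`.  Then:
(a) `|R|+|S|+|T| = n`, `|R| ≤ m`, `|S| > m`;
(b) `A = A[U₀,V₀]` (i.e. `A^1 = R ⊔ U₀`, `A^2 = T ⊔ V₀` and `(U₀,V₀) ∈ 𝒮`), `U₀`
consists of the `|U₀|` largest elements of `S`, and the Garnir coefficient of
`φ̂_A` is `1`;
(c) `φ̂_A = -∑_{(U,V) ∈ 𝒮, U ≠ U₀} coeff(U,V) φ̂_{A[U,V]}`, and every `A[U,V]` with
`U ≠ U₀` has strictly smaller first-row sum than `A`. -/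
theorem semistandardising_step
    {F : Type*} [Field F] {H : Type*} [Ring H] [Algebra F H]
    {n m : ℕ} (hn : 1 ≤ n) (hmn : m ≤ n) (hmm : n - m ≤ m)
    (q : F) (hq : q ≠ 0)
    (T : Equiv.Perm (Fin n) → H) (hT : IsHeckeBasis q T)
    (A0 A1 : Multiset ℕ) (hA0 : A0.card = m) (hA1 : A1.card = n - m)
    (lam : ℕ → ℕ) (hlam : ∀ v, lam v = (A0 + A1).count v)
    (mu : ℕ → ℕ) (hmu : mu = comp2 m (n - m))
    (i : ℕ) (hi : i < n - m)
    (hnotss : entryAt (rows2 A0 A1) 1 i ≤ entryAt (rows2 A0 A1) 0 i)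
    (j : ℕ) (hj : j = entryAt (rows2 A0 A1) 0 i)
    (R : Multiset ℕ) (hR : R = A0.filter (· < j))
    (U0 : Multiset ℕ) (hU0 : U0 = A0.filter (fun k => j ≤ k))
    (V0 : Multiset ℕ) (hV0 : V0 = A1.filter (· ≤ j))
    (Tt : Multiset ℕ) (hTt : Tt = A1.filter (fun k => j < k))
    (S : Multiset ℕ) (hS : S = U0 + V0)
    (wmu : Equiv.Perm (Fin n)) (hwmu : IsWmu mu wmu)
    (d : Multiset ℕ → Equiv.Perm (Fin n))
    (hd : ∀ U ∈ S.powerset.toFinset.filter (fun U => U.card + R.card = m),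
      Is1A mu lam (rows2 (R + U) (Tt + (S - U))) (d U))
    (Mmu : Submodule Hᵐᵒᵖ H) (hMmu : Mmu = Submodule.span Hᵐᵒᵖ {xElt T mu})
    (Smu : Submodule Hᵐᵒᵖ H)
    (hSmu : Smu = Submodule.span Hᵐᵒᵖ {xElt T mu * (T wmu * yElt q T (conjP mu))})
    (hle : Smu ≤ Mmu) (hx : xElt T mu ∈ Mmu)
    (φ : Multiset ℕ → (Mmu →ₗ[Hᵐᵒᵖ] H))
    (hφ : ∀ U ∈ S.powerset.toFinset.filter (fun U => U.card + R.card = m),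
      φ U ⟨xElt T mu, hx⟩ = XPhi T lam mu (d U)) :
    -- (a)
    (R.card + S.card + Tt.card = n ∧ R.card ≤ m ∧ m < S.card) ∧
    -- (b)
    (A0 = R + U0 ∧ A1 = Tt + V0 ∧ U0.card + R.card = m ∧ S - U0 = V0 ∧
      (∀ y ∈ V0, ∀ x ∈ U0, y ≤ x) ∧
      qBinomProd q R U0 * qBinomProd q Tt V0 *
        q ^ (invPairs R U0 + invPairs V0 Tt) = 1) ∧
    -- (c)
    ((∀ (z : H) (hz : z ∈ Smu),
        φ U0 ⟨z, hle hz⟩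
          = -∑ U ∈ (S.powerset.toFinset.filter
                (fun U => U.card + R.card = m)).erase U0,
              (qBinomProd q R U * qBinomProd q Tt (S - U) *
                q ^ (invPairs R U + invPairs (S - U) Tt)) • (φ U ⟨z, hle hz⟩)) ∧
      (∀ U ∈ S.powerset.toFinset.filter (fun U => U.card + R.card = m), U ≠ U0 →
        (R + U).sum < A0.sum)) := by
  have hA0' : A0 = R + U0 := by
    rw [hR, hU0, Multiset.filter_congr fun k _ => (not_lt (a := k) (b := j)).symm,
      Multiset.filter_add_not]
  have hA1' : A1 = Tt + V0 := by
    rw [hTt, hV0, Multiset.filter_congr fun k _ => (not_lt (a := j) (b := k)).symm,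
      Multiset.filter_add_not]
  have hcard0 : R.card + U0.card = m := by rw [← hA0, hA0', Multiset.card_add]
  have hcard1 : Tt.card + V0.card = n - m := by rw [← hA1, hA1', Multiset.card_add]
  have hcardS : S.card = U0.card + V0.card := by rw [hS, Multiset.card_add]
  have hU0card : m - i ≤ U0.card := by
    rw [hU0, hj, ← hA0]
    exact le_card_filter_le_getD_sort A0 (by omega)
  have hV0card : i + 1 ≤ V0.card := by
    refine (succ_le_card_filter_le_getD_sort A1 (by omega)).trans ?_
    rw [hV0, hj]
    exact Multiset.card_le_card (Multiset.monotone_filter_right _ fun k hk => hk.trans hnotss)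
  have hjU0 : ∀ x ∈ U0, j ≤ x := fun x hx => by
    rw [hU0] at hx
    exact (Multiset.mem_filter.1 hx).2
  have hjV0 : ∀ x ∈ V0, x ≤ j := fun x hx => by
    rw [hV0] at hx
    exact (Multiset.mem_filter.1 hx).2
  have hjR : ∀ x ∈ R, x < j := fun x hx => by
    rw [hR] at hx
    exact (Multiset.mem_filter.1 hx).2
  have hjT : ∀ x ∈ Tt, j < x := fun x hx => by
    rw [hTt] at hx
    exact (Multiset.mem_filter.1 hx).2
  have hSU0 : S - U0 = V0 := by rw [hS, add_tsub_cancel_left]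
  have hcoeff : qBinomProd q R U0 * qBinomProd q Tt V0 *
      q ^ (invPairs R U0 + invPairs V0 Tt) = 1 := by
    rw [qBinomProd_eq_one_of_disjoint q fun x hx hx' => (hjR x hx).not_ge (hjU0 x hx'),
      qBinomProd_eq_one_of_disjoint q fun x hx hx' => (hjT x hx).not_ge (hjV0 x hx'),
      invPairs_eq_zero fun x hx y hy => (hjR x hx).le.trans (hjU0 y hy),
      invPairs_eq_zero fun x hx y hy => (hjV0 x hx).trans (hjT y hy).le, mul_one, add_zero,
      pow_zero, mul_one]
  have hn' : R.card + S.card + Tt.card = n := by omega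
  refine ⟨⟨hn', by omega, by omega⟩, ⟨hA0', hA1', by omega, hSU0,
    fun y hy x hx => (hjV0 y hy).trans (hjU0 x hx), hcoeff⟩, ?_, ?_⟩
  · intro z hz
    subst hmu
    obtain ⟨c, rfl⟩ : ∃ c : Hᵐᵒᵖ, c • (xElt T (comp2 m (n - m)) *
        (T wmu * yElt q T (conjP (comp2 m (n - m))))) = z :=
      Submodule.mem_span_singleton.1 (hSmu ▸ hz)
    have hφz : ∀ U ∈ S.powerset.toFinset.filter (fun U => U.card + R.card = m),
        φ U ⟨_, hle hz⟩ = XPhi T lam (comp2 m (n - m)) (d U) *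
          (T wmu * yElt q T (conjP (comp2 m (n - m)))) * c.unop := by
      intro U hU
      have h : (⟨_, hle hz⟩ : Mmu) = MulOpposite.op
          ((T wmu * yElt q T (conjP (comp2 m (n - m)))) * c.unop) •
            ⟨xElt T (comp2 m (n - m)), hx⟩ := by
        refine Subtype.ext ?_
        change xElt T _ * _ * c.unop = xElt T _ * (_ * c.unop)
        rw [mul_assoc]
      rw [h, map_smul, hφ U hU, MulOpposite.smul_eq_mul_unop, MulOpposite.unop_op]
      exact (mul_assoc _ _ _).symm
    have hmem : U0 ∈ S.powerset.toFinset.filter (fun U => U.card + R.card = m) := by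
      rw [Finset.mem_filter, Multiset.mem_toFinset, Multiset.mem_powerset, hS]
      exact ⟨Multiset.le_add_right _ _, by omega⟩
    have hlam' : ∀ v, lam v = (R + S + Tt).count v := fun v => by
      rw [hlam, hA0', hA1', hS]
      congr 1
      abel
    have hgarnir := garnir_relation hT hq (by omega) hmm hlam' hn' (by omega) (by omega) hd (T wmu)
    have hsum : ∑ U ∈ S.powerset.toFinset.filter (fun U => U.card + R.card = m),
        (qBinomProd q R U * qBinomProd q Tt (S - U) *
          q ^ (invPairs R U + invPairs (S - U) Tt)) • φ U ⟨_, hle hz⟩ = 0 := by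
      rw [← zero_mul c.unop, ← hgarnir, Finset.sum_mul]
      refine Finset.sum_congr rfl fun U hU => ?_
      rw [hφz U hU, smul_mul_assoc, garnirWeight, garnirWeight, qBinomProd_comm q Tt, pow_add]
      congr 1
      ring
    rw [← Finset.add_sum_erase _ _ hmem, hSU0, hcoeff, one_smul] at hsum
    exact eq_neg_of_add_eq_zero_left hsum
  · intro U hU hne
    rw [Finset.mem_filter, Multiset.mem_toFinset, Multiset.mem_powerset] at hU
    rw [hA0', Multiset.sum_add, Multiset.sum_add, add_lt_add_iff_left]
    refine sum_lt_sum_of_card_eq (by omega) hne (fun x hx => hjV0 x ?_) hjU0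
    have hle' : U - U0 ≤ V0 := by
      rw [tsub_le_iff_left, ← hS]
      exact hU.1
    exact Multiset.mem_of_le hle' hx

end FayersSemistd
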